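/- In Setting (⋆), ln g can be used as a test function in the weak formulation for f: for all t ∈ [0,T], ∫ (ln g_t) f_t dv = ∫ (ln g₀) f₀ dv + ∫₀ᵗ ∫ (∂_s ln g_s) f_s dv ds − (1/2) ∫₀ᵗ ∬ a(v−v') (∇ ln g_s − ∇' ln g'_s) · ((∇−∇')(f_s f'_s)) dv dv' ds, where (∇−∇')(f_s f'_s) := 2 √(f_s f'_s) (∇−∇')√(f_s f'_s) with (∇−∇')√(f_s f'_s) the weak gradient; in particular every term in this identity is well-defined and finite. -/

import Mathlib

noncomputable section

open MeasureTheory Real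
open scoped ENNReal RealInnerProductSpace

/-- The velocity space ℝ³. -/
abbrev V3 : Type := EuclideanSpace ℝ (Fin 3)

/-- 3×3 real matrices. -/
abbrev Mat3 : Type := Matrix (Fin 3) (Fin 3) ℝ

/-- Japanese bracket ⟨v⟩ = √(1+|v|²). -/
def jap (v : V3) : ℝ := Real.sqrt (1 + ‖v‖ ^ 2)

/-- `i`-th basis vector of ℝ³. -/
def esingle (i : Fin 3) : V3 := EuclideanSpace.single i (1 : ℝ)

/-- Orthogonal projection Π(z) onto z^⊥. -/
def proj (z : V3) : Mat3 := fun i j =>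
  (if i = j then (1 : ℝ) else 0) - (z i / ‖z‖) * (z j / ‖z‖)

/-- Landau kernel a(z) = |z|^{γ+2} Π(z). -/
def landauKernel (γ : ℝ) (z : V3) : Mat3 := fun i j => ‖z‖ ^ (γ + 2) * proj z i j

/-- Cut-off kernel ã(z) = ⟨z⟩^γ |z|² Π(z). -/
def cutoffKernel (γ : ℝ) (z : V3) : Mat3 := fun i j => jap z ^ γ * ‖z‖ ^ 2 * proj z i j

/-- Bilinear form ⟨A w, z⟩. -/
def bilin (A : Mat3) (w z : V3) : ℝ := ∑ i, ∑ j, A i j * w i * z j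

/-- Quadratic form A : w^{⊗2}. -/
def quadForm (A : Mat3) (w : V3) : ℝ := bilin A w w

/-- Matrix dot product A : B. -/
def matDot (A B : Mat3) : ℝ := ∑ i, ∑ j, A i j * B i j

/-- (Frobenius) norm of a 3×3 matrix. -/
def matNorm (A : Mat3) : ℝ := Real.sqrt (∑ i, ∑ j, (A i j) ^ 2)

/-- Entropy H(f) = ∫ f ln f. -/
def entropy (f : V3 → ℝ) : ℝ := ∫ v, f v * Real.log (f v)

/-- Relative entropy H(f|g) = ∫ ((f/g) ln(f/g) − f/g + 1) g ∈ [0,∞]. -/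
def relEntropy (f g : V3 → ℝ) : ℝ≥0∞ :=
  ∫⁻ v, ENNReal.ofReal ((f v / g v * Real.log (f v / g v) - f v / g v + 1) * g v)

/-- Hessian matrix of a function on ℝ³. -/
def hess (φ : V3 → ℝ) (v : V3) : Mat3 := fun i j =>
  iteratedFDeriv ℝ 2 φ v ![esingle i, esingle j]

/-- Hessian matrix within a set. -/
def hessW (φ : V3 → ℝ) (s : Set V3) (v : V3) : Mat3 := fun i j =>
  iteratedFDerivWithin ℝ 2 φ s v ![esingle i, esingle j]

/-- Gradient of the logarithm, ∇ ln φ. -/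
def logGrad (φ : V3 → ℝ) (v : V3) : V3 := gradient (fun w => Real.log (φ w)) v

/-- Hessian of the logarithm, ∇² ln φ. -/
def logHess (φ : V3 → ℝ) (v : V3) : Mat3 := hess (fun w => Real.log (φ w)) v

/-- `G` is the weak gradient of `F` on ℝ⁶ ≃ ℝ³ × ℝ³. -/
def IsWeakGrad6 (F : V3 × V3 → ℝ) (G : V3 × V3 → V3 × V3) : Prop :=
  ∀ φ : V3 × V3 → ℝ, ContDiff ℝ (⊤ : ℕ∞) φ → HasCompactSupport φ →
    ∀ e : V3 × V3,
      (∫ p : V3 × V3, F p * fderiv ℝ φ p e) =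
        - ∫ p : V3 × V3, (⟪(G p).1, e.1⟫ + ⟪(G p).2, e.2⟫) * φ p

/-- `G` is the weak gradient of `F` on ℝ³. -/
def IsWeakGrad3 (F : V3 → ℝ) (G : V3 → V3) : Prop :=
  ∀ φ : V3 → ℝ, ContDiff ℝ (⊤ : ℕ∞) φ → HasCompactSupport φ →
    ∀ e : V3, (∫ v, F v * fderiv ℝ φ v e) = - ∫ v, ⟪G v, e⟫ * φ v

/-- Entropy production functional associated with a weak gradient of √(f f'). -/
def dissipation (γ : ℝ) (G : V3 × V3 → V3 × V3) : ℝ≥0∞ :=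
  ∫⁻ p : V3 × V3,
    ENNReal.ofReal (quadForm (landauKernel γ (p.1 - p.2)) ((G p).1 - (G p).2))

/-- Villani's H-solutions of the Landau equation on [0,T], with weak gradient data
`fGrad s` for √(f_s f_s'). -/
structure IsHSolution (γ T : ℝ) (f : ℝ → V3 → ℝ) (fGrad : ℝ → V3 × V3 → V3 × V3) : Prop where
  nonneg : ∀ t ∈ Set.Icc 0 T, ∀ v, 0 ≤ f t v
  integrable : ∀ t ∈ Set.Icc 0 T, Integrable (f t)
  entIntegrable : ∀ t ∈ Set.Icc 0 T, Integrable (fun v => f t v * Real.log (f t v))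
  contDistrib : ∀ φ : V3 → ℝ, ContDiff ℝ (⊤ : ℕ∞) φ → HasCompactSupport φ →
    ContinuousOn (fun t => ∫ v, φ v * f t v) (Set.Icc 0 T)
  mass : ∀ t ∈ Set.Icc 0 T, (∫ v, f t v) = 1
  momentumIntegrable : ∀ t ∈ Set.Icc 0 T, Integrable (fun v => f t v • v)
  momentum : ∀ t ∈ Set.Icc 0 T, (∫ v, f t v • v) = ∫ v, f 0 v • v
  energyIntegrable : ∀ t ∈ Set.Icc 0 T, Integrable (fun v => ‖v‖ ^ 2 * f t v)
  energy : ∀ t ∈ Set.Icc 0 T, (∫ v, ‖v‖ ^ 2 * f t v) = ∫ v, ‖v‖ ^ 2 * f 0 v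
  weakGrad : ∀ᵐ s ∂(volume.restrict (Set.Icc 0 T)),
    IsWeakGrad6 (fun p => Real.sqrt (f s p.1 * f s p.2)) (fGrad s)
  dissipationFinite : ∀ t ∈ Set.Icc 0 T,
    (∫⁻ s in Set.Ioc (0 : ℝ) t, dissipation γ (fGrad s)) < ⊤
  entropyProd : ∀ t ∈ Set.Icc 0 T,
    entropy (f t) + 2 * (∫⁻ s in Set.Ioc (0 : ℝ) t, dissipation γ (fGrad s)).toReal ≤
      entropy (f 0)
  weakForm : ∀ φ : ℝ → V3 → ℝ,
    ContDiff ℝ 2 (fun q : ℝ × V3 => φ q.1 q.2) →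
    HasCompactSupport (fun q : ℝ × V3 => φ q.1 q.2) →
    ∀ t ∈ Set.Icc 0 T,
      (∫ v, φ t v * f t v) - (∫ v, φ 0 v * f 0 v) =
        (∫ s in (0 : ℝ)..t, ∫ v, deriv (fun r => φ r v) s * f s v) -
          ∫ s in (0 : ℝ)..t, ∫ p : V3 × V3,
            bilin (landauKernel γ (p.1 - p.2))
              (gradient (φ s) p.1 - gradient (φ s) p.2)
              ((fGrad s p).1 - (fGrad s p).2) * Real.sqrt (f s p.1 * f s p.2)

/-- Convolved Landau matrix ā = a ⋆ f. -/
def abar (γ : ℝ) (f : V3 → ℝ) (v : V3) : Mat3 := fun i j =>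
  ∫ w, landauKernel γ (v - w) i j * f w

/-- Zero order coefficient c̄ of the Landau equation in nondivergence form. -/
def cbar (γ : ℝ) (f : V3 → ℝ) (v : V3) : ℝ :=
  if γ = -3 then 8 * Real.pi * f v else 2 * (γ + 3) * ∫ w, ‖v - w‖ ^ γ * f w

/-- Convolution of the cut-off kernel with a density. -/
def cutoffConv (γ : ℝ) (f : V3 → ℝ) (v : V3) : Mat3 := fun i j =>
  ∫ w, cutoffKernel γ (v - w) i j * f w

/-- Classical solution of the Landau equation on a time set `I`
(in nondivergence parabolic form ∂_t g = ā : ∇²g + c̄ g). -/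
structure IsClassicalSolution (γ : ℝ) (I : Set ℝ) (g : ℝ → V3 → ℝ) : Prop where
  pos : ∀ t ∈ I, ∀ v, 0 < g t v
  timeC1 : ∀ v, ContDiffOn ℝ 1 (fun t => g t v) I
  velC2 : ∀ t ∈ I, ContDiff ℝ 2 (g t)
  eqn : ∀ t ∈ I, ∀ v,
    derivWithin (fun s => g s v) I t =
      matDot (abar γ (g t) v) (hess (g t) v) + cbar γ (g t) v * g t v

/-- The moment exponent ρ = max(2κ, 2κ+2γ+4, 2ζ, ν). -/
def rhoExp (γ κ ζ ν : ℝ) : ℝ := max (max (2 * κ) (2 * κ + 2 * γ + 4)) (max (2 * ζ) ν)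

/-- Setting (⋆) of the paper. -/
structure Setting (γ T : ℝ) where
  f : ℝ → V3 → ℝ
  fGrad : ℝ → V3 × V3 → V3 × V3
  g : ℝ → V3 → ℝ
  κ : ℝ
  ν : ℝ
  ζ : ℝ
  K1 : ℝ → ℝ
  K2 : ℝ → ℝ
  K3 : ℝ → ℝ
  Mf : ℝ
  Mg : ℝ
  hγ : γ ∈ Set.Ico (-3 : ℝ) 0
  hT : 0 < T
  hf : IsHSolution γ T f fGrad
  hg : IsClassicalSolution γ (Set.Icc 0 T) g
  hκ : 1 ≤ κ
  hν : 1 ≤ ν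
  hζ : 0 ≤ ζ
  K1nonneg : ∀ t, 0 ≤ K1 t
  K2nonneg : ∀ t, 0 ≤ K2 t
  K3nonneg : ∀ t, 0 ≤ K3 t
  K1meas : Measurable K1
  K2meas : Measurable K2
  K3meas : Measurable K3
  K1bound : ∀ t ∈ Set.Icc 0 T, ∀ v, ‖logGrad (g t) v‖ ≤ K1 t * jap v ^ κ
  K2bound : ∀ t ∈ Set.Icc 0 T, ∀ v,
    |derivWithin (fun s => Real.log (g s v)) (Set.Icc 0 T) t| ≤ K2 t * jap v ^ ν
  K3bound : ∀ t ∈ Set.Icc 0 T, ∀ v, matNorm (logHess (g t) v) ≤ K3 t * jap v ^ ζ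
  Kint : IntegrableOn (fun t => K2 t + K1 t ^ 2 + K3 t ^ 2) (Set.Icc 0 T)
  fMomentInt : ∀ t ∈ Set.Icc 0 T,
    Integrable (fun v => jap v ^ (rhoExp γ κ ζ ν - γ) * f t v)
  fMoment : ∀ t ∈ Set.Icc 0 T, (∫ v, jap v ^ (rhoExp γ κ ζ ν - γ) * f t v) ≤ Mf
  gMomentInt : ∀ t ∈ Set.Icc 0 T,
    Integrable (fun v => jap v ^ (rhoExp γ κ ζ ν - γ) * g t v)
  gMoment : ∀ t ∈ Set.Icc 0 T, (∫ v, jap v ^ (rhoExp γ κ ζ ν - γ) * g t v) ≤ Mg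

/-- The good term 𝒢_s. -/
def goodTerm (γ : ℝ) (f g : ℝ → V3 → ℝ) (fGrad : ℝ → V3 × V3 → V3 × V3) (s : ℝ) : ℝ :=
  2 * ∫ p : V3 × V3,
    quadForm (landauKernel γ (p.1 - p.2))
      (((fGrad s p).1 - (fGrad s p).2) -
        Real.sqrt (f s p.1 * f s p.2) • (logGrad (g s) p.1 - logGrad (g s) p.2))

/-- The vector field a(v−v')(∇−∇')(g g'). -/
def landauFlux (γ : ℝ) (g : V3 → ℝ) (v w : V3) : Fin 3 → ℝ := fun i =>
  ∑ j, landauKernel γ (v - w) i j * (g w * (gradient g v) j - g v * (gradient g w) j)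

/-- (∇−∇')·[a(v−v')(∇−∇')(g g')]. -/
def divDiffFlux (γ : ℝ) (g : V3 → ℝ) (v w : V3) : ℝ :=
  ∑ i, (fderiv ℝ (fun z => landauFlux γ g z w i) v (esingle i) -
        fderiv ℝ (fun z => landauFlux γ g v z i) w (esingle i))

/-- The bad term ℬ_s. -/
def badTerm (γ : ℝ) (f g : ℝ → V3 → ℝ) (s : ℝ) : ℝ :=
  (1 / 2) * ∫ p : V3 × V3,
    (f s p.1 - g s p.1) * (f s p.2 - g s p.2) / (g s p.1 * g s p.2) *
      divDiffFlux γ (g s) p.1 p.2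

/-- Weighted relative Fisher information ∫ |2∇√f − √f ∇ln g|² ⟨v⟩^γ dv. -/
def relFisher (γ : ℝ) (f g : V3 → ℝ) (fGrad3 : V3 → V3) : ℝ :=
  ∫ v, ‖(2 : ℝ) • fGrad3 v - Real.sqrt (f v) • logGrad g v‖ ^ 2 * jap v ^ γ

/-- ‖⟨v⟩^{−κ} ∇ ln g_s‖_{L^∞(ℝ³)} ∈ [0,∞]. -/
def gradLogSup (g : ℝ → V3 → ℝ) (κ s : ℝ) : ℝ≥0∞ :=
  ⨆ v : V3, ENNReal.ofReal (jap v ^ (-κ) * ‖logGrad (g s) v‖)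

/-- ‖⟨v⟩^{−ν} ∂_s ln g_s‖_{L^∞(ℝ³)} ∈ [0,∞]. -/
def dtLogSup (g : ℝ → V3 → ℝ) (T ν s : ℝ) : ℝ≥0∞ :=
  ⨆ v : V3, ENNReal.ofReal
    (jap v ^ (-ν) * |derivWithin (fun r => Real.log (g r v)) (Set.Icc 0 T) s|)

/-- ‖⟨v⟩^{−ζ} ∇² ln g_s‖_{L^∞(ℝ³)} ∈ [0,∞]. -/
def hessLogSup (g : ℝ → V3 → ℝ) (ζ s : ℝ) : ℝ≥0∞ :=
  ⨆ v : V3, ENNReal.ofReal (jap v ^ (-ζ) * matNorm (logHess (g s) v))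

/-- Open cube Σ_R(v₀) = v₀ + (−R,R)³. -/
def cube (v₀ : V3) (R : ℝ) : Set V3 := {v | ∀ i, |v i - v₀ i| < R}

/-- Closed cube v₀ + [−R,R]³ centered at the origin. -/
def ccube (R : ℝ) : Set V3 := {v | ∀ i, |v i| ≤ R}

/-- Distance to the boundary of the cube Σ_R(v₀). -/
def dCube (v₀ : V3) (R : ℝ) (v : V3) : ℝ :=
  Finset.univ.inf' (Finset.univ_nonempty) fun i : Fin 3 => R - |v i - v₀ i|

/-- The moment exponent k(γ,ℓ,δ) of Theorem 2. -/
def kExp (γ ℓ δ : ℝ) : ℝ := 8 * (max (2 + (ℓ - 2) / (2 + δ)) 1 + (2 - γ) / (2 * δ)) - γ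

open Filter Topology Convolution in
theorem exists_measurable_version {X : Type*} [NormedAddCommGroup X] [NormedSpace ℝ X]
    [FiniteDimensional ℝ X] [MeasurableSpace X] [BorelSpace X] (μ : Measure X)
    [μ.IsAddHaarMeasure] (h : ℝ → X → ℝ) (hl : ∀ s, LocallyIntegrable (h s) μ)
    (hm : ∀ φ : X → ℝ, ContDiff ℝ (⊤ : ℕ∞) φ → HasCompactSupport φ →
      Measurable fun s => ∫ x, φ x * h s x ∂μ) :
    ∃ k : ℝ × X → ℝ, Measurable k ∧ ∀ s, ∀ᵐ x ∂μ, k (s, x) = h s x := by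
  let ψ : ℕ → ContDiffBump (0 : X) := fun n =>
    ⟨1 / ((n : ℝ) + 1), 2 / ((n : ℝ) + 1), by positivity, by gcongr; norm_num⟩
  have hψ : Tendsto (fun n => (ψ n).rOut) atTop (𝓝 0) := by
    have := (tendsto_one_div_add_atTop_nhds_zero_nat (𝕜 := ℝ)).const_mul 2
    simpa [ψ, div_eq_mul_inv] using this
  let H : ℕ → ℝ × X → ℝ := fun n p =>
    ((ψ n).normed μ ⋆[ContinuousLinearMap.lsmul ℝ ℝ, μ] h p.1) p.2
  have hH : ∀ n, Measurable (H n) := by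
    intro n
    have : Measurable (Function.uncurry fun (x : X) (s : ℝ) => H n (s, x)) := by
      apply measurable_uncurry_of_continuous_of_measurable
      · intro s
        exact ((ψ n).hasCompactSupport_normed).continuous_convolution_left _
          ((ψ n).continuous_normed) (hl s)
      · intro x
        have := hm (fun y => (ψ n).normed μ (x - y))
          ((ψ n).contDiff_normed.comp (contDiff_const.sub contDiff_id))
          ((ψ n).hasCompactSupport_normed.comp_homeomorph (Homeomorph.subLeft x))
        convert this using 2 with s
        simp [H, convolution_lsmul_swap]
    exact this.comp measurable_swap
  refine ⟨fun p => limUnder atTop (fun n => H n p), ?_, ?_⟩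
  · exact (StronglyMeasurable.limUnder fun n => (hH n).stronglyMeasurable).measurable
  · intro s
    filter_upwards [ContDiffBump.ae_convolution_tendsto_right_of_locallyIntegrable (K := 2)
      hψ (by filter_upwards with n; simp [ψ]; ring_nf; exact le_rfl) (hl s)] with x hx
    exact hx.limUnder_eq

/-- product rule, `u` being C¹ and `A` a primitive of `b`. -/
theorem product_rule_aux {t : ℝ} (ht : 0 ≤ t) (u A b : ℝ → ℝ)
    (hu : ContDiffOn ℝ 1 u (Set.Icc 0 t)) (hb : IntervalIntegrable b volume 0 t)
    (hA : ∀ r ∈ Set.Icc 0 t, A r = A 0 - ∫ s in (0:ℝ)..r, b s) :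
    u t * A t - u 0 * A 0 = (∫ s in (0:ℝ)..t, derivWithin u (Set.Icc 0 t) s * A s)
      - ∫ s in (0:ℝ)..t, u s * b s := by
  have hu1 : AbsolutelyContinuousOnInterval u 0 t :=
    ContDiffOn.absolutelyContinuousOnInterval (by rwa [Set.uIcc_of_le ht])
  have hP := hb.absolutelyContinuousOnInterval_intervalIntegral (c := 0) (by simp)
  have hP' := hu1.integral_mul_deriv_eq_deriv_mul hP
  have e1 : ∫ x in (0:ℝ)..t, u x * deriv (fun x => ∫ s in (0:ℝ)..x, b s) x
      = ∫ s in (0:ℝ)..t, u s * b s := by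
    apply intervalIntegral.integral_congr_ae
    filter_upwards [hb.ae_hasDerivAt_integral] with x hx hx'
    rw [(hx (Set.uIoc_subset_uIcc hx') 0 (by simp)).deriv]
  have hdw : ∀ s ∈ Set.Ioo 0 t, deriv u s = derivWithin u (Set.Icc 0 t) s := fun s hs =>
    (derivWithin_of_mem_nhds (Icc_mem_nhds hs.1 hs.2)).symm
  have hae : ∀ᵐ x : ℝ, x ∈ Set.uIoc 0 t → x ∈ Set.Ioo 0 t := by
    have : ∀ᵐ x : ℝ, x ≠ t := by simp [ae_iff]
    filter_upwards [this] with x hx hx'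
    rw [Set.uIoc_of_le ht] at hx'
    exact ⟨hx'.1, lt_of_le_of_ne hx'.2 hx⟩
  have e2 : ∫ x in (0:ℝ)..t, deriv u x * (∫ s in (0:ℝ)..x, b s)
      = ∫ x in (0:ℝ)..t, (derivWithin u (Set.Icc 0 t) x * A 0
        - derivWithin u (Set.Icc 0 t) x * A x) := by
    apply intervalIntegral.integral_congr_ae
    filter_upwards [hae] with x hx hx'
    rw [hdw x (hx hx'), hA x (Set.Ioo_subset_Icc_self (hx hx'))]
    ring
  have hcont : ContinuousOn (derivWithin u (Set.Icc 0 t)) (Set.uIcc 0 t) := by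
    rw [Set.uIcc_of_le ht]
    rcases ht.eq_or_lt with rfl | h0
    · simp
    · exact hu.continuousOn_derivWithin (uniqueDiffOn_Icc h0) le_rfl
  have hAc : ContinuousOn A (Set.uIcc 0 t) := by
    have : ContinuousOn (fun r => A 0 - ∫ s in (0:ℝ)..r, b s) (Set.uIcc 0 t) :=
      continuousOn_const.sub hP.continuousOn
    refine this.congr ?_
    rw [Set.uIcc_of_le ht]
    exact hA
  have e3 : ∫ x in (0:ℝ)..t, derivWithin u (Set.Icc 0 t) x = u t - u 0 := by
    rw [← hu1.integral_deriv_eq_sub]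
    apply intervalIntegral.integral_congr_ae
    filter_upwards [hae] with x hx hx'
    rw [hdw x (hx hx')]
  rw [e1, e2, intervalIntegral.integral_sub, intervalIntegral.integral_mul_const, e3] at hP'
  · have := hA t ⟨ht, le_rfl⟩
    simp only [intervalIntegral.integral_same] at hP'
    rw [this]
    linarith
  · exact (hcont.mul continuousOn_const).intervalIntegrable
  · exact (hcont.mul hAc).intervalIntegrable

open Filter Topology Convolution Classical in
theorem ae_zero_of_weak_deriv_zero {X : Type*} [NormedAddCommGroup X] [NormedSpace ℝ X]
    [FiniteDimensional ℝ X] [MeasurableSpace X] [BorelSpace X] (μ : Measure X)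
    [μ.IsAddHaarMeasure] (F : X → ℝ) (hF : AEStronglyMeasurable F μ)
    (hF2 : Integrable (fun x => F x ^ 2) μ) (e : X) (he : e ≠ 0)
    (h0 : ∀ φ : X → ℝ, ContDiff ℝ (⊤ : ℕ∞) φ → HasCompactSupport φ →
      ∫ x, F x * fderiv ℝ φ x e ∂μ = 0) : ∀ᵐ x ∂μ, F x = 0 := by
  have hL2 : MemLp F 2 μ := (memLp_two_iff_integrable_sq hF).2 hF2
  have hloc : LocallyIntegrable F μ := hL2.locallyIntegrable (by norm_num)
  apply ae_eq_zero_of_integral_contDiff_smul_eq_zero hloc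
  intro ψ hψ hψc
  have hψt : ContDiff ℝ (⊤ : ℕ∞) ψ := hψ
  -- J constant
  set J : ℝ → ℝ := fun t => ∫ x, F x * ψ (x + t • e) ∂μ with hJ
  have hder : ∀ t, HasDerivAt J 0 t := by
    intro t
    have hd : ∀ x τ, HasDerivAt (fun τ : ℝ => F x * ψ (x + τ • e))
        (F x * fderiv ℝ ψ (x + τ • e) e) τ := by
      intro x τ
      have h1 : HasDerivAt (fun τ : ℝ => x + τ • e) e τ := by
        simpa using ((hasDerivAt_id τ).smul_const e).const_add x
      have h2 : HasFDerivAt ψ (fderiv ℝ ψ (x + τ • e)) (x + τ • e) :=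
        (hψt.differentiable (by simp)).differentiableAt.hasFDerivAt
      exact (h2.comp_hasDerivAt τ h1).const_mul _
    have hcf : Continuous (fun x => fderiv ℝ ψ x e) :=
      (hψt.continuous_fderiv (by simp)).clm_apply continuous_const
    obtain ⟨C, hC⟩ := (hψc.fderiv_apply (𝕜 := ℝ) e).exists_bound_of_continuous hcf
    have hKc : IsCompact ((fun q : X × ℝ => q.1 - q.2 • e) '' (tsupport ψ ×ˢ Metric.closedBall t 1)) :=
      (hψc.isCompact.prod (isCompact_closedBall t 1)).image (by fun_prop)
    set K := (fun q : X × ℝ => q.1 - q.2 • e) '' (tsupport ψ ×ˢ Metric.closedBall t 1)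
    have hKm : MeasurableSet K := hKc.measurableSet
    have key := hasDerivAt_integral_of_dominated_loc_of_deriv_le (μ := μ)
      (F := fun τ x => F x * ψ (x + τ • e)) (x₀ := t)
      (F' := fun τ x => F x * fderiv ℝ ψ (x + τ • e) e)
      (bound := K.indicator fun x => ‖F x‖ * C) (s := Metric.ball t 1)
      (Metric.ball_mem_nhds t one_pos)
      (Eventually.of_forall fun τ => hF.mul (by
        have : Continuous fun x => ψ (x + τ • e) := hψt.continuous.comp (by fun_prop)
        exact this.aestronglyMeasurable))
      ?_ (hF.mul (by
        have : Continuous fun x => fderiv ℝ ψ (x + t • e) e := hcf.comp (by fun_prop)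
        exact this.aestronglyMeasurable)) ?_ ?_ ?_
    · have h3 := h0 (fun x => ψ (x + t • e)) (hψt.comp (contDiff_id.add contDiff_const))
        (hψc.comp_homeomorph (Homeomorph.addRight (t • e)))
      have h4 : ∀ x, fderiv ℝ (fun x => ψ (x + t • e)) x = fderiv ℝ ψ (x + t • e) := fun x =>
        fderiv_comp_add_right _
      simp only [h4] at h3
      have := key.2
      simp only [h3] at this
      exact this
    · have := hloc.integrable_smul_left_of_hasCompactSupport
        (g := fun x => ψ (x + t • e)) (hψt.continuous.comp (by fun_prop))
        (hψc.comp_homeomorph (Homeomorph.addRight (t • e)))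
      simpa [mul_comm] using this
    · refine Eventually.of_forall fun x τ hτ => ?_
      by_cases hx : x ∈ K
      · rw [Set.indicator_of_mem hx, norm_mul]
        gcongr
        exact hC _
      · rw [Set.indicator_of_notMem hx]
        have : x + τ • e ∉ tsupport ψ := by
          intro hh
          exact hx ⟨(x + τ • e, τ), ⟨hh, Metric.ball_subset_closedBall hτ⟩, by simp⟩
        have h5 : fderiv ℝ ψ (x + τ • e) = 0 := by
          by_contra hne
          exact this (support_fderiv_subset ℝ hne)
        simp [h5]
    · rw [integrable_indicator_iff hKm]
      exact ((hloc.integrableOn_isCompact hKc).norm).mul_const C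
    · exact Eventually.of_forall fun x τ _ => hd x τ
  have hconst : ∀ t, J t = J 0 := fun t =>
    is_const_of_deriv_eq_zero (fun t => (hder t).differentiableAt) (fun t => (hder t).deriv) t 0
  have hψ2 : Integrable (fun x => ψ x ^ 2) μ := by
    have : HasCompactSupport (fun x => ψ x ^ 2) := by
      have h7 : HasCompactSupport (ψ * ψ) := hψc.mul_left
      have h8 : (fun x => ψ x ^ 2) = ψ * ψ := by ext x; simp [pow_two]
      rwa [h8]
    exact (hψt.continuous.pow 2).integrable_of_hasCompactSupport this
  -- tail
  have htail : Tendsto (fun n : ℕ => ∫ x, (if x + (n : ℝ) • e ∈ tsupport ψ then F x ^ 2 else 0) ∂μ)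
      atTop (𝓝 (∫ x, (0 : ℝ) ∂μ)) := by
    apply tendsto_integral_of_dominated_convergence (fun x => F x ^ 2)
    · intro n
      have hm : MeasurableSet {x : X | x + (n : ℝ) • e ∈ tsupport ψ} :=
        (isClosed_tsupport ψ).measurableSet.preimage (by fun_prop : Continuous fun x : X => x + (n:ℝ) • e).measurable
      exact (hF2.aestronglyMeasurable.indicator hm).congr (Eventually.of_forall fun x => by
        simp [Set.indicator_apply])
    · exact hF2
    · intro n
      refine Eventually.of_forall fun x => ?_
      split_ifs <;> simp [sq_nonneg]
    · refine Eventually.of_forall fun x => ?_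
      obtain ⟨R, hR⟩ := hψc.isCompact.isBounded.exists_norm_le
      obtain ⟨N, hN⟩ := exists_nat_gt ((R + ‖x‖) / ‖e‖)
      apply tendsto_const_nhds.congr'
      filter_upwards [eventually_ge_atTop N] with n hn
      rw [if_neg]
      intro hmem
      have h1 := hR _ hmem
      have he' : 0 < ‖e‖ := norm_pos_iff.2 he
      have h2 : ‖(n : ℝ) • e‖ = n * ‖e‖ := by simp [norm_smul]
      have h3 : ‖(n : ℝ) • e‖ ≤ ‖x + (n:ℝ) • e‖ + ‖x‖ := by
        have := norm_sub_le (x + (n:ℝ) • e) x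
        simpa using this
      rw [div_lt_iff₀ he'] at hN
      have : (N : ℝ) * ‖e‖ ≤ n * ‖e‖ := by gcongr
      linarith
  simp only [integral_zero] at htail
  have hbound : ∀ c > 0, ∀ n : ℕ, |J 0| ≤ c / 2 * (∫ x, ψ x ^ 2 ∂μ) +
      1 / (2 * c) * ∫ x, (if x + (n : ℝ) • e ∈ tsupport ψ then F x ^ 2 else 0) ∂μ := by
    intro c hc n
    rw [← hconst n]
    have hint2 : Integrable (fun x => (if x + (n : ℝ) • e ∈ tsupport ψ then F x ^ 2 else 0)) μ := by
      have hm : MeasurableSet {x : X | x + (n : ℝ) • e ∈ tsupport ψ} :=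
        (isClosed_tsupport ψ).measurableSet.preimage (by fun_prop : Continuous fun x : X => x + (n:ℝ) • e).measurable
      exact (hF2.indicator hm).congr (Eventually.of_forall fun x => by
        simp [Set.indicator_apply])
    have hψn : Integrable (fun x => ψ (x + (n:ℝ) • e) ^ 2) μ := hψ2.comp_add_right _
    have e1 : ∫ x, ψ (x + (n:ℝ) • e) ^ 2 ∂μ = ∫ x, ψ x ^ 2 ∂μ :=
      integral_add_right_eq_self (μ := μ) (fun x => ψ x ^ 2) ((n:ℝ) • e)
    rw [← e1, ← integral_const_mul, ← integral_const_mul, ← integral_add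
      (hψn.const_mul _) (hint2.const_mul _)]
    rw [← Real.norm_eq_abs]
    apply norm_integral_le_of_norm_le ((hψn.const_mul _).add (hint2.const_mul _))
    refine Eventually.of_forall fun x => ?_
    by_cases hx : x + (n : ℝ) • e ∈ tsupport ψ
    · simp only [hx, if_true, Real.norm_eq_abs, abs_mul, Pi.add_apply]
      rw [← sq_abs (ψ _), ← sq_abs (F x)]
      have : 0 ≤ (c * |ψ (x + (n : ℝ) • e)| - |F x|) ^ 2 / (2 * c) := by positivity
      have h6 : (c * |ψ (x + (n : ℝ) • e)| - |F x|) ^ 2 / (2 * c)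
        = c / 2 * |ψ (x + (n : ℝ) • e)| ^ 2 + 1 / (2 * c) * |F x| ^ 2
          - |F x| * |ψ (x + (n : ℝ) • e)| := by field_simp; ring
      linarith
    · simp [hx, image_eq_zero_of_notMem_tsupport hx]
  have hb2 : ∀ c > 0, |J 0| ≤ c / 2 * (∫ x, ψ x ^ 2 ∂μ) := by
    intro c hc
    refine ge_of_tendsto (x := atTop)
      (f := fun n : ℕ => c / 2 * (∫ x, ψ x ^ 2 ∂μ) +
        1 / (2 * c) * ∫ x, (if x + (n : ℝ) • e ∈ tsupport ψ then F x ^ 2 else 0) ∂μ) ?_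
      (Eventually.of_forall fun n => hbound c hc n)
    simpa using (htail.const_mul (1 / (2 * c))).const_add (c / 2 * (∫ x, ψ x ^ 2 ∂μ))
  have hI : 0 ≤ ∫ x, ψ x ^ 2 ∂μ := integral_nonneg fun x => sq_nonneg _
  have hz : |J 0| ≤ 0 := by
    refine le_of_forall_pos_le_add fun ε hε => ?_
    have := hb2 (ε / ((∫ x, ψ x ^ 2 ∂μ) + 1)) (by positivity)
    refine this.trans ?_
    rw [zero_add, div_div, div_mul_eq_mul_div, div_le_iff₀ (by positivity)]
    nlinarith
  have := abs_nonpos_iff.1 hz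
  simp only [hJ, zero_smul, add_zero] at this
  simpa [mul_comm] using this

instance instHaarV3V3 : (volume : Measure (V3 × V3)).IsAddHaarMeasure := by
  rw [Measure.volume_eq_prod]; infer_instance

theorem f_version {γ T : ℝ} {f : ℝ → V3 → ℝ} {fGrad : ℝ → V3 × V3 → V3 × V3}
    (hf : IsHSolution γ T f fGrad) :
    ∃ F : ℝ × V3 → ℝ, Measurable F ∧ (∀ q, 0 ≤ F q) ∧
      ∀ s ∈ Set.Icc 0 T, ∀ᵐ v, F (s, v) = f s v := by
  classical
  obtain ⟨k, hk, hk2⟩ := exists_measurable_version (volume : Measure V3)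
    (fun s v => if s ∈ Set.Icc 0 T then f s v else 0) (by
      intro s
      by_cases hs : s ∈ Set.Icc 0 T
      · simpa only [hs, if_true] using (hf.integrable s hs).locallyIntegrable
      · simpa only [hs, if_false] using locallyIntegrable_zero) (by
      intro φ hφ hφc
      have h1 := hf.contDistrib φ hφ hφc
      have h2 : (fun s => ∫ x, φ x * (if s ∈ Set.Icc 0 T then f s x else 0))
        = (Set.Icc 0 T).indicator (fun t => ∫ v, φ v * f t v) := by
        ext s
        by_cases hs : s ∈ Set.Icc 0 T <;> simp [hs]
      rw [h2]
      rw [← Set.piecewise_eq_indicator]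
      exact h1.measurable_piecewise continuousOn_const measurableSet_Icc)
  refine ⟨fun q => max (k q) 0, hk.max measurable_const, fun q => le_max_right _ _, ?_⟩
  intro s hs
  filter_upwards [hk2 s] with v hv
  rw [hv, if_pos hs, max_eq_left (hf.nonneg s hs v)]

theorem sqrt_prod_aesm {f : V3 → ℝ} (hi : Integrable f) :
    AEStronglyMeasurable (fun p : V3 × V3 => √(f p.1 * f p.2)) := by
  have h1 : AEStronglyMeasurable (fun p : V3 × V3 => f p.1 * f p.2) :=
    (hi.mul_prod hi).aestronglyMeasurable
  exact Real.continuous_sqrt.comp_aestronglyMeasurable h1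

theorem sqrt_prod_sq {f : V3 → ℝ} (h0 : ∀ v, 0 ≤ f v) (p : V3 × V3) :
    √(f p.1 * f p.2) ^ 2 = f p.1 * f p.2 := Real.sq_sqrt (mul_nonneg (h0 _) (h0 _))

theorem sqrt_prod_loc {f : V3 → ℝ} (h0 : ∀ v, 0 ≤ f v) (hi : Integrable f) :
    LocallyIntegrable (fun p : V3 × V3 => √(f p.1 * f p.2)) := by
  have hL2 : MemLp (fun p : V3 × V3 => √(f p.1 * f p.2)) 2 := by
    rw [memLp_two_iff_integrable_sq (sqrt_prod_aesm hi)]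
    simp only [sqrt_prod_sq h0]
    exact hi.mul_prod hi
  exact hL2.locallyIntegrable (by norm_num)

theorem weakGrad_int {f : V3 → ℝ} (h0 : ∀ v, 0 ≤ f v) (hi : Integrable f) (hm : ∫ v, f v = 1)
    {G : V3 × V3 → V3 × V3} (hG : IsWeakGrad6 (fun p => √(f p.1 * f p.2)) G)
    (φ : V3 × V3 → ℝ) (hφ : ContDiff ℝ (⊤ : ℕ∞) φ) (hφc : HasCompactSupport φ) (e : V3 × V3) :
    Integrable (fun p : V3 × V3 => (⟪(G p).1, e.1⟫ + ⟪(G p).2, e.2⟫) * φ p) := by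
  by_contra hn
  have he : e ≠ 0 := by
    rintro rfl
    exact hn (by simp)
  have hz : ∀ ψ : V3 × V3 → ℝ, ContDiff ℝ (⊤ : ℕ∞) ψ → HasCompactSupport ψ →
      ¬ Integrable (fun p : V3 × V3 => (⟪(G p).1, e.1⟫ + ⟪(G p).2, e.2⟫) * ψ p) →
      ∫ p : V3 × V3, √(f p.1 * f p.2) * fderiv ℝ ψ p e = 0 := by
    intro ψ h1 h2 h3
    rw [hG ψ h1 h2 e, integral_undef h3, neg_zero]
  have hint : ∀ ψ : V3 × V3 → ℝ, ContDiff ℝ (⊤ : ℕ∞) ψ → HasCompactSupport ψ →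
      Integrable (fun p : V3 × V3 => √(f p.1 * f p.2) * fderiv ℝ ψ p e) := by
    intro ψ h1 h2
    have := (sqrt_prod_loc h0 hi).integrable_smul_left_of_hasCompactSupport
      (g := fun p => fderiv ℝ ψ p e)
      ((h1.continuous_fderiv (by simp)).clm_apply continuous_const) (h2.fderiv_apply (𝕜 := ℝ) e)
    simpa [mul_comm] using this
  have hall : ∀ ψ : V3 × V3 → ℝ, ContDiff ℝ (⊤ : ℕ∞) ψ → HasCompactSupport ψ →
      ∫ p : V3 × V3, √(f p.1 * f p.2) * fderiv ℝ ψ p e = 0 := by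
    intro ψ h1 h2
    by_cases h3 : Integrable (fun p : V3 × V3 => (⟪(G p).1, e.1⟫ + ⟪(G p).2, e.2⟫) * ψ p)
    · have h4 : ¬ Integrable (fun p : V3 × V3 =>
          (⟪(G p).1, e.1⟫ + ⟪(G p).2, e.2⟫) * (φ + ψ) p) := by
        intro h5
        apply hn
        refine (h5.sub h3).congr (Filter.Eventually.of_forall fun p => ?_)
        simp only [Pi.sub_apply, Pi.add_apply]
        ring
      have h6 := hz (φ + ψ) (hφ.add h1) (hφc.add h2) h4
      have h7 : ∀ p, fderiv ℝ (φ + ψ) p e = fderiv ℝ φ p e + fderiv ℝ ψ p e := by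
        intro p
        rw [fderiv_add (hφ.differentiable (by simp) p) (h1.differentiable (by simp) p)]
        rfl
      simp only [h7, mul_add] at h6
      rw [integral_add (hint φ hφ hφc) (hint ψ h1 h2), hz φ hφ hφc hn, zero_add] at h6
      exact h6
    · exact hz ψ h1 h2 h3
  have hae := ae_zero_of_weak_deriv_zero (volume : Measure (V3 × V3)) _ (sqrt_prod_aesm hi)
    (by simp only [sqrt_prod_sq h0]; exact hi.mul_prod hi) e he hall
  have h1 : ∫ p : V3 × V3, f p.1 * f p.2 = 1 := by
    rw [Measure.volume_eq_prod, integral_prod_mul, hm, one_mul]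
  have h2 : ∫ p : V3 × V3, f p.1 * f p.2 = 0 := by
    apply integral_eq_zero_of_ae
    filter_upwards [hae] with p hp
    rw [← sqrt_prod_sq h0, hp]
    simp
  rw [h2] at h1
  exact zero_ne_one h1

theorem locInt_of_bumps {X : Type*} [NormedAddCommGroup X] [NormedSpace ℝ X]
    [FiniteDimensional ℝ X] [MeasurableSpace X] [BorelSpace X] (μ : Measure X)
    (h : X → ℝ) (hh : ∀ φ : X → ℝ, ContDiff ℝ (⊤ : ℕ∞) φ → HasCompactSupport φ →
      Integrable (fun x => h x * φ x) μ) : LocallyIntegrable h μ := by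
  intro x
  let ψ : ContDiffBump x := ⟨1, 2, one_pos, by norm_num⟩
  refine ⟨Metric.closedBall x 1, Metric.closedBall_mem_nhds x one_pos, ?_⟩
  have h1 := (hh ψ ψ.contDiff ψ.hasCompactSupport).integrableOn (s := Metric.closedBall x 1)
  refine h1.congr_fun (fun y hy => ?_) measurableSet_closedBall
  have : ψ y = 1 := ψ.one_of_mem_closedBall hy
  simp [this]

theorem G_version {γ T : ℝ} {f : ℝ → V3 → ℝ} {fGrad : ℝ → V3 × V3 → V3 × V3}
    (hf : IsHSolution γ T f fGrad) :
    ∃ W : ℝ × (V3 × V3) → V3, Measurable W ∧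
      ∀ᵐ s ∂(volume.restrict (Set.Icc 0 T)),
        ∀ᵐ p : V3 × V3, W (s, p) = (fGrad s p).1 - (fGrad s p).2 := by
  classical
  obtain ⟨F, hF, hF0, hFe⟩ := f_version hf
  set N := toMeasurable (volume.restrict (Set.Icc 0 T))
    {s | ¬ IsWeakGrad6 (fun p => √(f s p.1 * f s p.2)) (fGrad s)} with hN
  have hN0 : volume.restrict (Set.Icc 0 T) N = 0 := by
    rw [hN, measure_toMeasurable]; exact hf.weakGrad
  have hNm : MeasurableSet N := measurableSet_toMeasurable _ _
  set Gd := Set.Icc 0 T \ N with hGd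
  have hGm : MeasurableSet Gd := measurableSet_Icc.diff hNm
  have hGw : ∀ s ∈ Gd, IsWeakGrad6 (fun p => √(f s p.1 * f s p.2)) (fGrad s) := by
    intro s hs
    by_contra hc
    exact hs.2 (subset_toMeasurable _ _ hc)
  have hae : ∀ᵐ s ∂(volume.restrict (Set.Icc 0 T)), s ∈ Gd := by
    have h1 : ∀ᵐ s ∂(volume.restrict (Set.Icc 0 T)), s ∉ N := measure_eq_zero_iff_ae_notMem.1 hN0
    filter_upwards [h1, ae_restrict_mem measurableSet_Icc] with s h2 h3
    exact ⟨h3, h2⟩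
  have key : ∀ i : Fin 3, ∃ k : ℝ × (V3 × V3) → ℝ, Measurable k ∧ ∀ s, ∀ᵐ p : V3 × V3,
      k (s, p) = if s ∈ Gd then (⟪(fGrad s p).1, esingle i⟫ + ⟪(fGrad s p).2, -esingle i⟫) else 0 := by
    intro i
    apply exists_measurable_version (volume : Measure (V3 × V3))
    · intro s
      by_cases hs : s ∈ Gd
      · simp only [hs, if_true]
        apply locInt_of_bumps
        intro φ h1 h2
        exact weakGrad_int (hf.nonneg s hs.1) (hf.integrable s hs.1) (hf.mass s hs.1)
          (hGw s hs) φ h1 h2 (esingle i, -esingle i)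
      · simpa only [hs, if_false] using locallyIntegrable_zero
    · intro φ h1 h2
      have h3 : (fun s => ∫ p : V3 × V3, φ p * (if s ∈ Gd then
          (⟪(fGrad s p).1, esingle i⟫ + ⟪(fGrad s p).2, -esingle i⟫) else 0))
          = Gd.indicator (fun s => - ∫ p : V3 × V3, √(F (s, p.1) * F (s, p.2)) *
            fderiv ℝ φ p (esingle i, -esingle i)) := by
        ext s
        by_cases hs : s ∈ Gd
        · simp only [hs, if_true, Set.indicator_of_mem]
          have h4 := hGw s hs φ h1 h2 (esingle i, -esingle i)
          simp only [mul_comm (φ _)]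
          rw [← neg_eq_iff_eq_neg.2 h4]
          congr 1
          apply integral_congr_ae
          have h5 := hFe s hs.1
          have h6 : ∀ᵐ p : V3 × V3, F (s, p.1) = f s p.1 :=
            Measure.quasiMeasurePreserving_fst.ae h5
          have h7 : ∀ᵐ p : V3 × V3, F (s, p.2) = f s p.2 :=
            Measure.quasiMeasurePreserving_snd.ae h5
          filter_upwards [h6, h7] with p h8 h9
          rw [h8, h9]
        · simp [hs]
      rw [h3]
      refine Measurable.indicator ?_ hGm
      apply Measurable.neg
      have h4 : Measurable (fun q : ℝ × (V3 × V3) => √(F (q.1, q.2.1) * F (q.1, q.2.2)) *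
            fderiv ℝ φ q.2 (esingle i, -esingle i)) := by
        apply Measurable.mul
        · fun_prop
        · have : Continuous (fun p => fderiv ℝ φ p (esingle i, -esingle i)) :=
            (h1.continuous_fderiv (by simp)).clm_apply continuous_const
          exact this.measurable.comp measurable_snd
      exact (h4.stronglyMeasurable.integral_prod_right).measurable
  choose k hk hk2 using key
  refine ⟨fun q => WithLp.toLp 2 (fun i => k i q), ?_, ?_⟩
  · exact (PiLp.continuous_toLp 2 _).measurable.comp (measurable_pi_lambda _ fun i => hk i)
  · filter_upwards [hae] with s hs
    have h1 : ∀ᵐ p : V3 × V3, ∀ i, k i (s, p) = if s ∈ Gd then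
      (⟪(fGrad s p).1, esingle i⟫ + ⟪(fGrad s p).2, -esingle i⟫) else 0 := ae_all_iff.2 fun i => hk2 i s
    filter_upwards [h1] with p hp
    ext i
    simp only [hp, hs, if_true]
    simp [esingle, EuclideanSpace.inner_single_right]
    ring

theorem jap_ge_one (v : V3) : 1 ≤ jap v := by
  unfold jap
  rw [Real.one_le_sqrt]
  nlinarith [sq_nonneg ‖v‖]

theorem jap_pos (v : V3) : 0 < jap v := lt_of_lt_of_le one_pos (jap_ge_one v)

theorem jap_continuous : Continuous jap := by
  unfold jap
  fun_prop

theorem norm_le_jap (v : V3) : ‖v‖ ≤ jap v := by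
  unfold jap
  apply Real.le_sqrt_of_sq_le
  linarith

theorem jap_le_add (v w : V3) : jap w ≤ jap v + ‖v - w‖ := by
  have h1 : ‖w‖ ≤ ‖v‖ + ‖v - w‖ := by
    have := norm_sub_le v (v - w)
    simpa using this
  have h2 := norm_le_jap v
  have h3 : jap v ^ 2 = 1 + ‖v‖ ^ 2 := by unfold jap; rw [Real.sq_sqrt]; positivity
  have h4 := jap_pos v
  unfold jap at h4 ⊢
  apply Real.sqrt_le_iff.2
  refine ⟨by positivity, ?_⟩
  change 1 + ‖w‖ ^ 2 ≤ (jap v + ‖v - w‖) ^ 2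
  have h5 : ‖w‖ ^ 2 ≤ (‖v‖ + ‖v - w‖) ^ 2 := by gcongr
  nlinarith [norm_nonneg (v - w), norm_nonneg v]

theorem jap_le_one_add (v : V3) : jap v ≤ 1 + ‖v‖ := by
  unfold jap
  apply Real.sqrt_le_iff.2
  refine ⟨by positivity, ?_⟩
  nlinarith [norm_nonneg v]

theorem jap_rpow_mono {a b : ℝ} (h : a ≤ b) (v : V3) : jap v ^ a ≤ jap v ^ b :=
  Real.rpow_le_rpow_of_exponent_le (jap_ge_one v) h

theorem jap_rpow_pos (a : ℝ) (v : V3) : 0 < jap v ^ a := Real.rpow_pos_of_pos (jap_pos v) a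

theorem jap_rpow_cont (a : ℝ) : Continuous fun v => jap v ^ a :=
  jap_continuous.rpow_const fun v => Or.inl (jap_pos v).ne'

theorem landauKernel_meas (γ : ℝ) (i j : Fin 3) : Measurable fun z => landauKernel γ z i j := by
  unfold landauKernel proj
  have h1 : ∀ i : Fin 3, Measurable fun z : V3 => z i := fun i =>
    (PiLp.continuous_apply 2 _ i).measurable
  have := h1 i
  have := h1 j
  fun_prop

theorem quad_proj (z w : V3) : quadForm (proj z) w = ‖w‖ ^ 2 - (⟪z, w⟫ / ‖z‖) ^ 2 := by
  unfold quadForm bilin proj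
  rw [EuclideanSpace.norm_sq_eq w, PiLp.inner_apply]
  simp [Fin.sum_univ_three]
  ring

theorem quad_landau (γ : ℝ) (z w : V3) :
    quadForm (landauKernel γ z) w = ‖z‖ ^ (γ + 2) * quadForm (proj z) w := by
  unfold quadForm bilin landauKernel
  simp only [Finset.mul_sum]
  refine Finset.sum_congr rfl fun i _ => Finset.sum_congr rfl fun j _ => ?_
  ring

theorem quad_proj_nonneg (z w : V3) : 0 ≤ quadForm (proj z) w := by
  rw [quad_proj]
  have h1 := abs_real_inner_le_norm z w
  rcases eq_or_ne z 0 with rfl | hz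
  · simp
  · have hz' : 0 < ‖z‖ := norm_pos_iff.2 hz
    have h2 : |⟪z, w⟫ / ‖z‖| ≤ ‖w‖ := by
      rw [abs_div, abs_of_pos hz', div_le_iff₀ hz']
      linarith
    have h3 := sq_le_sq' (by linarith [neg_abs_le (⟪z, w⟫ / ‖z‖)]) ((le_abs_self _).trans h2)
    linarith

theorem quad_nonneg (γ : ℝ) (z w : V3) : 0 ≤ quadForm (landauKernel γ z) w := by
  rw [quad_landau]
  have := quad_proj_nonneg z w
  positivity

theorem quad_le (γ : ℝ) (z w : V3) : quadForm (landauKernel γ z) w ≤ ‖z‖ ^ (γ + 2) * ‖w‖ ^ 2 := by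
  rw [quad_landau, quad_proj]
  gcongr
  linarith [sq_nonneg (⟪z, w⟫ / ‖z‖)]

theorem landau_symm (γ : ℝ) (z : V3) (i j : Fin 3) :
    landauKernel γ z i j = landauKernel γ z j i := by
  unfold landauKernel proj
  simp only [eq_comm (a := i) (b := j)]
  ring

theorem bilin_abs_le (γ : ℝ) (z u w : V3) : |bilin (landauKernel γ z) u w| ≤
    1 / 2 * (quadForm (landauKernel γ z) u + quadForm (landauKernel γ z) w) := by
  have h1 := quad_nonneg γ z (u + w)
  have h2 := quad_nonneg γ z (u - w)
  have e1 : quadForm (landauKernel γ z) (u + w) = quadForm (landauKernel γ z) u +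
      quadForm (landauKernel γ z) w + 2 * bilin (landauKernel γ z) u w := by
    unfold quadForm bilin
    simp [Fin.sum_univ_three, landau_symm γ z 1 0, landau_symm γ z 2 0, landau_symm γ z 2 1]
    ring
  have e2 : quadForm (landauKernel γ z) (u - w) = quadForm (landauKernel γ z) u +
      quadForm (landauKernel γ z) w - 2 * bilin (landauKernel γ z) u w := by
    unfold quadForm bilin
    simp [Fin.sum_univ_three, landau_symm γ z 1 0, landau_symm γ z 2 0, landau_symm γ z 2 1]
    ring
  rw [abs_le]
  constructor <;> linarith

/-- the vector `c a(z) W`. -/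
def thetaV (γ : ℝ) (z W : V3) (c : ℝ) : V3 :=
  WithLp.toLp 2 (fun i => (∑ j, landauKernel γ z i j * W j) * c)

theorem bilin_eq_inner (γ : ℝ) (z u W : V3) (c : ℝ) :
    bilin (landauKernel γ z) u W * c = ⟪u, thetaV γ z W c⟫ := by
  unfold bilin thetaV
  rw [PiLp.inner_apply]
  simp only [Finset.sum_mul]
  refine Finset.sum_congr rfl fun i _ => ?_
  simp only [RCLike.inner_apply, conj_trivial, Finset.sum_mul]
  refine Finset.sum_congr rfl fun j _ => ?_
  ring

theorem bilin_smul_right (A : Mat3) (u W : V3) (c : ℝ) : bilin A u (c • W) = bilin A u W * c := by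
  unfold bilin
  simp only [Finset.sum_mul]
  refine Finset.sum_congr rfl fun i _ => Finset.sum_congr rfl fun j _ => ?_
  simp
  ring

theorem bilin_smul_left (A : Mat3) (u W : V3) (c : ℝ) : bilin A (c • u) W = bilin A u W * c := by
  unfold bilin
  simp only [Finset.sum_mul]
  refine Finset.sum_congr rfl fun i _ => Finset.sum_congr rfl fun j _ => ?_
  simp
  ring

theorem thetaV_dom (γ : ℝ) (z u W : V3) (c : ℝ) :
    |⟪u, thetaV γ z W c⟫| ≤
      1 / 2 * (‖z‖ ^ (γ + 2) * ‖u‖ ^ 2 * c ^ 2 + quadForm (landauKernel γ z) W) := by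
  rw [← bilin_eq_inner, ← bilin_smul_left]
  refine (bilin_abs_le γ z _ _).trans ?_
  have := quad_le γ z (c • u)
  rw [norm_smul, mul_pow, Real.norm_eq_abs, sq_abs] at this
  nlinarith

theorem thetaV_meas {α : Type*} [MeasurableSpace α] (γ : ℝ) {z W : α → V3} {c : α → ℝ}
    (hz : Measurable z) (hW : Measurable W) (hc : Measurable c) :
    Measurable fun x => thetaV γ (z x) (W x) (c x) := by
  have h1 : ∀ i : Fin 3, Measurable fun x => (W x) i := fun i =>
    (PiLp.continuous_apply 2 _ i).measurable.comp hW
  have h2 : ∀ i j, Measurable fun x => landauKernel γ (z x) i j := fun i j =>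
    (landauKernel_meas γ i j).comp hz
  refine (PiLp.continuous_toLp 2 _).measurable.comp (measurable_pi_lambda _ fun i => ?_)
  exact (Finset.measurable_sum _ fun j _ => (h2 i j).mul (h1 j)).mul hc

theorem quad_meas {α : Type*} [MeasurableSpace α] (γ : ℝ) {z W : α → V3}
    (hz : Measurable z) (hW : Measurable W) :
    Measurable fun x => quadForm (landauKernel γ (z x)) (W x) := by
  have h1 : ∀ i : Fin 3, Measurable fun x => (W x) i := fun i =>
    (PiLp.continuous_apply 2 _ i).measurable.comp hW
  have h2 : ∀ i j, Measurable fun x => landauKernel γ (z x) i j := fun i j =>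
    (landauKernel_meas γ i j).comp hz
  unfold quadForm bilin
  exact Finset.measurable_sum _ fun i _ => Finset.measurable_sum _ fun j _ =>
    ((h2 i j).mul (h1 i)).mul (h1 j)

theorem admissible {γ κ ξ m C : ℝ} (hγ : γ ∈ Set.Ico (-3 : ℝ) 0) (hC : 0 ≤ C)
    (h1 : 2 * κ ≤ m) (h2 : 2 * κ + γ + 2 ≤ m) (h3 : 2 * ξ ≤ m) (v v' u : V3)
    (hu1 : ‖u‖ ≤ C * (max (jap v) (jap v')) ^ κ)
    (hu2 : ‖v - v'‖ ≤ 1 → ‖u‖ ≤ C * ‖v - v'‖ * (max (jap v) (jap v')) ^ ξ) :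
    ‖v - v'‖ ^ (γ + 2) * ‖u‖ ^ 2 ≤ 4 * C ^ 2 * (jap v ^ m + jap v' ^ m) := by
  set M := max (jap v) (jap v') with hM
  have hM1 : 1 ≤ M := (jap_ge_one v).trans (le_max_left _ _)
  have hM0 : 0 < M := by linarith
  have hMm : M ^ m ≤ jap v ^ m + jap v' ^ m := by
    have e1 := jap_rpow_pos m v
    have e2 := jap_rpow_pos m v'
    rcases max_choice (jap v) (jap v') with h | h <;> rw [hM, h] <;> linarith
  suffices ‖v - v'‖ ^ (γ + 2) * ‖u‖ ^ 2 ≤ 4 * C ^ 2 * M ^ m by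
    refine this.trans ?_
    gcongr
  have sq : ∀ a : ℝ, (M ^ a) ^ 2 = M ^ (2 * a) := fun a => by
    rw [← Real.rpow_natCast, ← Real.rpow_mul hM0.le]; congr 1; push_cast; ring
  obtain ⟨hγ1, hγ2⟩ := hγ
  have hMp : 0 < M ^ m := Real.rpow_pos_of_pos hM0 _
  have hC2 : 0 ≤ C ^ 2 * M ^ m := by positivity
  have base : ∀ a, 2 * a ≤ m → (C * M ^ a) ^ 2 ≤ C ^ 2 * M ^ m := by
    intro a ha
    rw [mul_pow, sq]
    gcongr
  rcases le_or_gt ‖v - v'‖ 1 with hz | hz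
  · have hu := hu2 hz
    rcases eq_or_lt_of_le (norm_nonneg (v - v')) with h0 | h0
    · have : ‖u‖ = 0 := by
        rw [← h0] at hu
        have := norm_nonneg u
        simp at hu
        simp [hu]
      rw [this]
      simp
      linarith
    · have e1 : ‖u‖ ^ 2 ≤ (C * ‖v - v'‖ * M ^ ξ) ^ 2 := by gcongr
      have e2 : ‖v - v'‖ ^ (γ + 2) * ‖v - v'‖ ^ 2 ≤ 1 := by
        rw [← Real.rpow_natCast, ← Real.rpow_add h0]
        apply Real.rpow_le_one h0.le hz
        push_cast; linarith
      calc ‖v - v'‖ ^ (γ + 2) * ‖u‖ ^ 2 ≤ ‖v - v'‖ ^ (γ + 2) * (C * ‖v - v'‖ * M ^ ξ) ^ 2 := by gcongr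
        _ = (‖v - v'‖ ^ (γ + 2) * ‖v - v'‖ ^ 2) * (C * M ^ ξ) ^ 2 := by ring
        _ ≤ 1 * (C ^ 2 * M ^ m) := by
          gcongr
          exact base ξ h3
        _ ≤ 4 * C ^ 2 * M ^ m := by linarith
  · have e1 : ‖u‖ ^ 2 ≤ (C * M ^ κ) ^ 2 := by gcongr
    rcases le_or_gt (γ + 2) 0 with hg | hg
    · have e2 : ‖v - v'‖ ^ (γ + 2) ≤ 1 := Real.rpow_le_one_of_one_le_of_nonpos hz.le hg
      calc ‖v - v'‖ ^ (γ + 2) * ‖u‖ ^ 2 ≤ 1 * (C ^ 2 * M ^ m) := by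
            gcongr
            exact e1.trans (base κ h1)
        _ ≤ 4 * C ^ 2 * M ^ m := by linarith
    · have e3 : ‖v - v'‖ ≤ 2 * M := by
        have := norm_sub_le v v'
        have := norm_le_jap v
        have := norm_le_jap v'
        have := le_max_left (jap v) (jap v')
        have := le_max_right (jap v) (jap v')
        linarith
      have e4 : (2 : ℝ) ^ (γ + 2) ≤ 4 := by
        calc (2 : ℝ) ^ (γ + 2) ≤ 2 ^ (2 : ℝ) :=
              Real.rpow_le_rpow_of_exponent_le (by norm_num) (by linarith)
          _ = 4 := by norm_num
      have e2 : ‖v - v'‖ ^ (γ + 2) ≤ 4 * M ^ (γ + 2) := by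
        calc ‖v - v'‖ ^ (γ + 2) ≤ (2 * M) ^ (γ + 2) := by gcongr
          _ = 2 ^ (γ + 2) * M ^ (γ + 2) := Real.mul_rpow (by norm_num) hM0.le
          _ ≤ 4 * M ^ (γ + 2) := by gcongr
      calc ‖v - v'‖ ^ (γ + 2) * ‖u‖ ^ 2 ≤ (4 * M ^ (γ + 2)) * (C * M ^ κ) ^ 2 := by gcongr
        _ = 4 * C ^ 2 * M ^ (γ + 2 + 2 * κ) := by
          rw [mul_pow, sq, Real.rpow_add hM0 (γ + 2)]; ring
        _ ≤ 4 * C ^ 2 * M ^ m := by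
          gcongr
          linarith

/-- the moment exponent -/
def mExp {γ T : ℝ} (S : Setting γ T) : ℝ := rhoExp γ S.κ S.ζ S.ν - γ

/-- measurable versions of `f` and of the weak gradient difference. -/
structure Ver {γ T : ℝ} (S : Setting γ T) (F : ℝ × V3 → ℝ) (W : ℝ × (V3 × V3) → V3) : Prop where
  Fm : Measurable F
  F0 : ∀ q, 0 ≤ F q
  Feq : ∀ s ∈ Set.Icc 0 T, ∀ᵐ v, F (s, v) = S.f s v
  Wm : Measurable W
  Weq : ∀ᵐ s ∂(volume.restrict (Set.Ioc 0 T)),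
        ∀ᵐ p : V3 × V3, W (s, p) = (S.fGrad s p).1 - (S.fGrad s p).2

theorem exists_ver {γ T : ℝ} (S : Setting γ T) : ∃ F W, Ver S F W := by
  obtain ⟨F, h1, h2, h3⟩ := f_version S.hf
  obtain ⟨W, h4, h5⟩ := G_version S.hf
  exact ⟨F, W, h1, h2, h3, h4, ae_restrict_of_ae_restrict_of_subset Set.Ioc_subset_Icc_self h5⟩

/-- the flux -/
def Theta (γ : ℝ) (F : ℝ × V3 → ℝ) (W : ℝ × (V3 × V3) → V3) (q : ℝ × (V3 × V3)) : V3 :=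
  thetaV γ (q.2.1 - q.2.2) (W q) (√(F (q.1, q.2.1) * F (q.1, q.2.2)))

section
variable {γ T : ℝ} {S : Setting γ T} {F : ℝ × V3 → ℝ} {W : ℝ × (V3 × V3) → V3}

theorem Theta_meas (V : Ver S F W) : Measurable (Theta γ F W) := by
  have := V.Fm
  apply thetaV_meas
  · fun_prop
  · exact V.Wm
  · fun_prop

theorem F_mom (V : Ver S F W) {s : ℝ} (hs : s ∈ Set.Icc 0 T) :
    Integrable (fun v => jap v ^ mExp S * F (s, v)) ∧
    ∫ v, jap v ^ mExp S * F (s, v) ≤ S.Mf ∧ Integrable (fun v => F (s, v)) ∧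
    ∫ v, F (s, v) = 1 := by
  have h := V.Feq s hs
  have h' : (fun v => jap v ^ mExp S * F (s, v)) =ᵐ[volume] fun v => jap v ^ mExp S * S.f s v := by
    filter_upwards [h] with v hv
    rw [hv]
  have h2 : (fun v => F (s, v)) =ᵐ[volume] S.f s := h
  refine ⟨(integrable_congr h').2 (S.fMomentInt s hs), ?_, (integrable_congr h2).2 (S.hf.integrable s hs), ?_⟩
  · rw [integral_congr_ae h']
    exact S.fMoment s hs
  · rw [integral_congr_ae h2]
    exact S.hf.mass s hs

theorem F_mom_lt (V : Ver S F W) {s : ℝ} (hs : s ∈ Set.Icc 0 T) {a C : ℝ} (ha : a ≤ mExp S)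
    {h : V3 → ℝ} (hm : AEStronglyMeasurable h) (hb : ∀ v, |h v| ≤ C * jap v ^ a) (hC : 0 ≤ C) :
    Integrable (fun v => h v * F (s, v)) ∧ |∫ v, h v * F (s, v)| ≤ C * S.Mf := by
  obtain ⟨h1, h2, h3, h4⟩ := F_mom V hs
  have hle : ∀ v, ‖h v * F (s, v)‖ ≤ C * (jap v ^ mExp S * F (s, v)) := by
    intro v
    rw [norm_mul, Real.norm_eq_abs, Real.norm_eq_abs, abs_of_nonneg (V.F0 _), ← mul_assoc]
    gcongr
    · exact V.F0 _
    · exact (hb v).trans (mul_le_mul_of_nonneg_left (jap_rpow_mono ha v) hC)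
  refine ⟨(h1.const_mul C).mono' (hm.mul h3.aestronglyMeasurable) (Filter.Eventually.of_forall hle), ?_⟩
  refine (norm_integral_le_of_norm_le (h1.const_mul C) (Filter.Eventually.of_forall hle)).trans ?_
  rw [integral_const_mul]
  gcongr

theorem momdom_integrable (V : Ver S F W) {c : ℝ → ℝ} (hc0 : ∀ s, 0 ≤ c s)
    (hc : IntegrableOn c (Set.Ioc 0 T)) :
    Integrable (fun q : ℝ × (V3 × V3) => c q.1 * (jap q.2.1 ^ mExp S + jap q.2.2 ^ mExp S) *
      (F (q.1, q.2.1) * F (q.1, q.2.2))) ((volume.restrict (Set.Ioc 0 T)).prod volume) := by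
  have hjap : Measurable jap := jap_continuous.measurable
  have hjm : Measurable fun v => jap v ^ mExp S := (jap_rpow_cont _).measurable
  have hFm := V.Fm
  have hinner : ∀ s ∈ Set.Ioc 0 T, Integrable (fun p : V3 × V3 =>
        (jap p.1 ^ mExp S + jap p.2 ^ mExp S) * (F (s, p.1) * F (s, p.2))) ∧
      ∫ p : V3 × V3, (jap p.1 ^ mExp S + jap p.2 ^ mExp S) * (F (s, p.1) * F (s, p.2)) ≤
        2 * S.Mf := by
    intro s hs
    obtain ⟨h1, h2, h3, h4⟩ := F_mom V (Set.Ioc_subset_Icc_self hs)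
    have i1 := h1.mul_prod h3
    have i2 := h3.mul_prod h1
    rw [← Measure.volume_eq_prod] at i1 i2
    have e : (fun p : V3 × V3 =>
        (jap p.1 ^ mExp S + jap p.2 ^ mExp S) * (F (s, p.1) * F (s, p.2))) =
        fun p => (jap p.1 ^ mExp S * F (s, p.1)) * F (s, p.2) +
          F (s, p.1) * (jap p.2 ^ mExp S * F (s, p.2)) := by
      ext p; ring
    rw [e]
    refine ⟨i1.add i2, ?_⟩
    rw [integral_add i1 i2, Measure.volume_eq_prod, 
      integral_prod_mul (fun v => jap v ^ mExp S * F (s, v)) (fun v => F (s, v)),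
      integral_prod_mul (fun v => F (s, v)) (fun v => jap v ^ mExp S * F (s, v)), h4]
    linarith
  rw [integrable_prod_iff]
  · constructor
    · filter_upwards [ae_restrict_mem measurableSet_Ioc] with s hs
      simpa only [mul_assoc] using (hinner s hs).1.const_mul (c s)
    · have hcm : AEStronglyMeasurable (fun s => ∫ p : V3 × V3, ‖c s * (jap p.1 ^ mExp S + jap p.2 ^ mExp S) *
          (F (s, p.1) * F (s, p.2))‖) (volume.restrict (Set.Ioc 0 T)) := by
        have : (fun s => ∫ p : V3 × V3, ‖c s * (jap p.1 ^ mExp S + jap p.2 ^ mExp S) *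
          (F (s, p.1) * F (s, p.2))‖) = fun s => ‖c s‖ * ∫ p : V3 × V3, ‖(jap p.1 ^ mExp S + jap p.2 ^ mExp S) *
          (F (s, p.1) * F (s, p.2))‖ := by
          ext s
          rw [← integral_const_mul]
          simp only [norm_mul, mul_assoc]
        rw [this]
        refine hc.aestronglyMeasurable.norm.mul ?_
        have hm : Measurable (fun q : ℝ × (V3 × V3) => ‖(jap q.2.1 ^ mExp S + jap q.2.2 ^ mExp S) *
          (F (q.1, q.2.1) * F (q.1, q.2.2))‖) := by fun_prop
        exact (hm.stronglyMeasurable.integral_prod_right).aestronglyMeasurable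
      refine (hc.mul_const (2 * S.Mf)).mono' hcm ?_
      filter_upwards [ae_restrict_mem measurableSet_Ioc] with s hs
      obtain ⟨h1, h2⟩ := hinner s hs
      have e : ∀ p : V3 × V3, ‖c s * (jap p.1 ^ mExp S + jap p.2 ^ mExp S) * (F (s, p.1) * F (s, p.2))‖
        = c s * ((jap p.1 ^ mExp S + jap p.2 ^ mExp S) * (F (s, p.1) * F (s, p.2))) := by
        intro p
        rw [Real.norm_eq_abs, abs_of_nonneg, mul_assoc]
        have := jap_rpow_pos (mExp S) p.1
        have := jap_rpow_pos (mExp S) p.2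
        have := V.F0 (s, p.1)
        have := V.F0 (s, p.2)
        have := hc0 s
        positivity
      simp only [e]
      rw [integral_const_mul, Real.norm_eq_abs, abs_of_nonneg]
      · gcongr
        exact hc0 s
      · refine mul_nonneg (hc0 s) (integral_nonneg fun p => ?_)
        have := jap_rpow_pos (mExp S) p.1
        have := jap_rpow_pos (mExp S) p.2
        have := V.F0 (s, p.1)
        have := V.F0 (s, p.2)
        simp only [Pi.zero_apply]
        positivity
  · refine AEStronglyMeasurable.mul (AEStronglyMeasurable.mul ?_ ?_) ?_
    · exact hc.aestronglyMeasurable.comp_fst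
    · exact Measurable.aestronglyMeasurable (by fun_prop)
    · exact Measurable.aestronglyMeasurable (by fun_prop)

theorem quad_integrable (V : Ver S F W) :
    Integrable (fun q : ℝ × (V3 × V3) => quadForm (landauKernel γ (q.2.1 - q.2.2)) (W q))
      ((volume.restrict (Set.Ioc 0 T)).prod volume) := by
  have hm : Measurable (fun q : ℝ × (V3 × V3) => quadForm (landauKernel γ (q.2.1 - q.2.2)) (W q)) :=
    quad_meas γ (by fun_prop) V.Wm
  refine ⟨hm.aestronglyMeasurable, ?_⟩
  rw [hasFiniteIntegral_iff_ofReal (Filter.Eventually.of_forall fun q => quad_nonneg _ _ _)]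
  rw [lintegral_prod _ hm.ennreal_ofReal.aemeasurable]
  refine lt_of_le_of_lt (le_of_eq ?_) (S.hf.dissipationFinite T ⟨S.hT.le, le_rfl⟩)
  apply lintegral_congr_ae
  filter_upwards [V.Weq] with s hs
  unfold dissipation
  apply lintegral_congr_ae
  filter_upwards [hs] with p hp
  rw [hp]

/-- the dominating function -/
def Dom (S : Setting γ T) (F : ℝ × V3 → ℝ) (W : ℝ × (V3 × V3) → V3) (c : ℝ → ℝ)
    (q : ℝ × (V3 × V3)) : ℝ :=
  1 / 2 * (c q.1 * (jap q.2.1 ^ mExp S + jap q.2.2 ^ mExp S) *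
      (F (q.1, q.2.1) * F (q.1, q.2.2)) + quadForm (landauKernel γ (q.2.1 - q.2.2)) (W q))

theorem Dom_integrable (V : Ver S F W) {c : ℝ → ℝ} (hc0 : ∀ s, 0 ≤ c s)
    (hc : IntegrableOn c (Set.Ioc 0 T)) :
    Integrable (Dom S F W c) ((volume.restrict (Set.Ioc 0 T)).prod volume) :=
  ((momdom_integrable V hc0 hc).add (quad_integrable V)).const_mul _

theorem exp_facts (S : Setting γ T) : 2 * S.κ ≤ mExp S ∧ 2 * S.κ + γ + 2 ≤ mExp S ∧
    2 * S.ζ ≤ mExp S ∧ S.ν ≤ mExp S ∧ S.κ + 1 ≤ mExp S ∧ 0 ≤ mExp S := by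
  have h1 := S.hγ.2
  have h2 := S.hκ
  have h3 := S.hγ.1
  unfold mExp rhoExp
  have e1 := le_max_left (max (2 * S.κ) (2 * S.κ + 2 * γ + 4)) (max (2 * S.ζ) S.ν)
  have e2 := le_max_right (max (2 * S.κ) (2 * S.κ + 2 * γ + 4)) (max (2 * S.ζ) S.ν)
  have e3 := le_max_left (2 * S.κ) (2 * S.κ + 2 * γ + 4)
  have e4 := le_max_right (2 * S.κ) (2 * S.κ + 2 * γ + 4)
  have e5 := le_max_left (2 * S.ζ) S.ν
  have e6 := le_max_right (2 * S.ζ) S.ν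
  refine ⟨?_, ?_, ?_, ?_, ?_, ?_⟩ <;> linarith

theorem inner_Theta_le (V : Ver S F W) {c : ℝ → ℝ} (q : ℝ × (V3 × V3)) (u : V3) (C : ℝ) (hC : 0 ≤ C)
    (hc : 4 * C ^ 2 ≤ c q.1)
    (hu1 : ‖u‖ ≤ C * (max (jap q.2.1) (jap q.2.2)) ^ S.κ)
    (hu2 : ‖q.2.1 - q.2.2‖ ≤ 1 →
      ‖u‖ ≤ C * ‖q.2.1 - q.2.2‖ * (max (jap q.2.1) (jap q.2.2)) ^ (max S.κ S.ζ)) :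
    ‖(⟪u, Theta γ F W q⟫ : ℝ)‖ ≤ Dom S F W c q := by
  obtain ⟨h1, h2, h3, -, -, -⟩ := exp_facts S
  have h4 : 2 * max S.κ S.ζ ≤ mExp S := by
    rcases max_choice S.κ S.ζ with h | h <;> rw [h] <;> assumption
  have h5 := admissible S.hγ hC h1 h2 h4 q.2.1 q.2.2 u hu1 hu2
  have h6 := thetaV_dom γ (q.2.1 - q.2.2) u (W q) (√(F (q.1, q.2.1) * F (q.1, q.2.2)))
  have hF := mul_nonneg (V.F0 (q.1, q.2.1)) (V.F0 (q.1, q.2.2))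
  rw [Real.sq_sqrt hF] at h6
  rw [Real.norm_eq_abs]
  refine h6.trans ?_
  unfold Dom
  have e1 := jap_rpow_pos (mExp S) q.2.1
  have e2 := jap_rpow_pos (mExp S) q.2.2
  have h7 := mul_le_mul_of_nonneg_right (h5.trans (mul_le_mul_of_nonneg_right hc (add_pos e1 e2).le)) hF
  linarith
end

section
variable {γ T : ℝ}

/-- log g -/
def LL (S : Setting γ T) (s : ℝ) (w : V3) : ℝ := Real.log (S.g s w)

theorem LL_time (S : Setting γ T) (w : V3) : ContDiffOn ℝ 1 (fun r => LL S r w) (Set.Icc 0 T) :=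
  (S.hg.timeC1 w).log (fun r hr => (S.hg.pos r hr w).ne')

theorem LL_vel (S : Setting γ T) {s : ℝ} (hs : s ∈ Set.Icc 0 T) : ContDiff ℝ 2 (LL S s) :=
  (S.hg.velC2 s hs).log (fun v => (S.hg.pos s hs v).ne')

theorem LL_grad (S : Setting γ T) {s : ℝ} (hs : s ∈ Set.Icc 0 T) (v : V3) :
    HasGradientAt (LL S s) (logGrad (S.g s) v) v :=
  (((LL_vel S hs).differentiable (by norm_num)) v).hasGradientAt

theorem norm_gradient_eq (h : V3 → ℝ) (v : V3) : ‖gradient h v‖ = ‖fderiv ℝ h v‖ := by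
  simp [gradient]

theorem gradient_continuous {h : V3 → ℝ} (hh : ContDiff ℝ 1 h) : Continuous (gradient h) :=
  (LinearIsometryEquiv.continuous _).comp (hh.continuous_fderiv (by norm_num))

theorem gradient_contDiff {n : ℕ∞} {h : V3 → ℝ} (hh : ContDiff ℝ (n + 1) h) : ContDiff ℝ n (gradient h) :=
  (LinearIsometryEquiv.contDiff _).comp (hh.fderiv_right (m := n) le_rfl)

theorem logGrad_cont (S : Setting γ T) {s : ℝ} (hs : s ∈ Set.Icc 0 T) :
    Continuous (logGrad (S.g s)) :=
  gradient_continuous (h := LL S s) ((LL_vel S hs).of_le (by norm_num))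

theorem LL_lip (S : Setting γ T) {s : ℝ} (hs : s ∈ Set.Icc 0 T) (x y : V3) (C : ℝ)
    (hC : ∀ z ∈ segment ℝ x y, jap z ^ S.κ ≤ C) : |LL S s y - LL S s x| ≤ S.K1 s * C * ‖y - x‖ := by
  refine Convex.norm_image_sub_le_of_norm_fderiv_le (𝕜 := ℝ) (s := segment ℝ x y) (fun z _ => ((LL_vel S hs).differentiable (by norm_num)) z)
    (fun z hz => ?_) (convex_segment x y) (left_mem_segment ℝ x y) (right_mem_segment ℝ x y)
  rw [← norm_gradient_eq]
  exact (S.K1bound s hs z).trans (mul_le_mul_of_nonneg_left (hC z hz) (S.K1nonneg s))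

theorem norm_fderiv2_le (h : V3 → ℝ) (z : V3) :
    ‖fderiv ℝ (fderiv ℝ h) z‖ ≤ 9 * matNorm (hess h z) := by
  have hn : 0 ≤ matNorm (hess h z) := Real.sqrt_nonneg _
  have hij : ∀ i j, |hess h z i j| ≤ matNorm (hess h z) := by
    intro i j
    rw [← Real.sqrt_sq_eq_abs]
    apply Real.sqrt_le_sqrt
    exact (Finset.single_le_sum (f := fun j => (hess h z i j) ^ 2) (fun j _ => sq_nonneg _) (Finset.mem_univ j)).trans
      (Finset.single_le_sum (f := fun i => ∑ j, (hess h z i j) ^ 2) (fun i _ => Finset.sum_nonneg fun j _ => sq_nonneg _) (Finset.mem_univ i))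
  refine ContinuousLinearMap.opNorm_le_bound _ (by positivity) fun u => ?_
  refine ContinuousLinearMap.opNorm_le_bound _ (by positivity) fun u' => ?_
  have e : ∀ u : V3, u = ∑ i, u i • esingle i := by
    intro u
    ext k
    simp [esingle, Finset.sum_apply, Pi.single_apply]
  have hval : fderiv ℝ (fderiv ℝ h) z u u' = ∑ i, ∑ j, u i * u' j * hess h z i j := by
    conv_lhs => rw [e u, e u']
    simp only [map_sum, map_smul, _root_.sum_apply, _root_.smul_apply, smul_eq_mul, Finset.mul_sum]
    rw [Finset.sum_comm]
    refine Finset.sum_congr rfl fun i _ => Finset.sum_congr rfl fun j _ => ?_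
    simp only [hess, iteratedFDeriv_two_apply]
    simp
    ring
  rw [hval]
  have hb : ∀ i j, ‖u i * u' j * hess h z i j‖ ≤ ‖u‖ * ‖u'‖ * matNorm (hess h z) := by
    intro i j
    rw [norm_mul, norm_mul]
    have h1 := PiLp.norm_apply_le u i
    have h2 := PiLp.norm_apply_le u' j
    have h3 := hij i j
    rw [← Real.norm_eq_abs] at h3
    gcongr
  refine (norm_sum_le _ _).trans ((Finset.sum_le_sum fun i _ => (norm_sum_le _ _).trans (Finset.sum_le_sum fun j _ => hb i j)).trans ?_)
  simp
  linarith

theorem DD_lip (S : Setting γ T) {s : ℝ} (hs : s ∈ Set.Icc 0 T) (x y : V3) (C : ℝ)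
    (hC : ∀ z ∈ segment ℝ x y, jap z ^ S.ζ ≤ C) :
    ‖logGrad (S.g s) y - logGrad (S.g s) x‖ ≤ 9 * (S.K3 s * C) * ‖y - x‖ := by
  have h1 : ‖logGrad (S.g s) y - logGrad (S.g s) x‖ = ‖fderiv ℝ (LL S s) y - fderiv ℝ (LL S s) x‖ := by
    unfold logGrad gradient
    rw [← map_sub, LinearIsometryEquiv.norm_map]
    rfl
  rw [h1]
  refine Convex.norm_image_sub_le_of_norm_fderiv_le (𝕜 := ℝ) (s := segment ℝ x y) 
    (fun z _ => (((LL_vel S hs).fderiv_right (m := 1) (by norm_num)).differentiable (by norm_num)) z)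
    (fun z hz => ?_) (convex_segment x y) (left_mem_segment ℝ x y) (right_mem_segment ℝ x y)
  refine (norm_fderiv2_le _ z).trans ?_
  gcongr
  exact (S.K3bound s hs z).trans (mul_le_mul_of_nonneg_left (hC z hz) (S.K3nonneg s))

theorem Kint_facts (S : Setting γ T) : IntegrableOn S.K2 (Set.Ioc 0 T) ∧
    IntegrableOn (fun s => S.K1 s ^ 2) (Set.Ioc 0 T) ∧ IntegrableOn (fun s => S.K3 s ^ 2) (Set.Ioc 0 T) := by
  have h := S.Kint.mono_set (Set.Ioc_subset_Icc_self (a := (0:ℝ)) (b := T))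
  have h1 := S.K1meas
  have h2 := S.K2meas
  have h3 := S.K3meas
  refine ⟨h.mono' h2.aestronglyMeasurable ?_, h.mono' (h1.pow_const 2).aestronglyMeasurable ?_, h.mono' (h3.pow_const 2).aestronglyMeasurable ?_⟩ <;>
  · refine Filter.Eventually.of_forall fun s => ?_
    have := S.K2nonneg s
    have := sq_nonneg (S.K1 s)
    have := sq_nonneg (S.K3 s)
    rw [Real.norm_eq_abs, abs_of_nonneg (by assumption)]
    linarith

/-- constant -/
def c0 (S : Setting γ T) : ℝ := |LL S 0 0| + ∫ s in Set.Ioc 0 T, S.K2 s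

theorem c0_nonneg (S : Setting γ T) : 0 ≤ c0 S :=
  add_nonneg (abs_nonneg _) (integral_nonneg fun s => S.K2nonneg s)

theorem LL_zero_bd (S : Setting γ T) {s : ℝ} (hs : s ∈ Set.Icc 0 T) : |LL S s 0| ≤ c0 S := by
  have h1 : ContDiffOn ℝ 1 (fun r => LL S r 0) (Set.Icc 0 s) :=
    (LL_time S 0).mono (Set.Icc_subset_Icc_right hs.2)
  have h2 := intervalIntegral.integral_derivWithin_Icc_of_contDiffOn_Icc h1 hs.1
  have h3 : |LL S s 0 - LL S 0 0| ≤ ∫ r in Set.Ioc 0 T, S.K2 r := by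
    rw [← h2, intervalIntegral.integral_of_le hs.1]
    have hK : IntegrableOn S.K2 (Set.Ioc 0 s) := (Kint_facts S).1.mono_set (Set.Ioc_subset_Ioc_right hs.2)
    rw [← Real.norm_eq_abs]
    refine (norm_integral_le_of_norm_le hK ?_).trans (setIntegral_mono_set (Kint_facts S).1 (Filter.Eventually.of_forall fun r => S.K2nonneg r) (Set.Ioc_subset_Ioc_right hs.2).eventuallyLE)
    have : ∀ᵐ r ∂(volume.restrict (Set.Ioc 0 s)), r ≠ s := ae_restrict_of_ae (Measure.ae_ne volume s)
    filter_upwards [ae_restrict_mem measurableSet_Ioc, this] with r hr hne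
    have hr' : r < s := lt_of_le_of_ne hr.2 hne
    have e : derivWithin (fun r => LL S r 0) (Set.Icc 0 s) r = derivWithin (fun r => LL S r 0) (Set.Icc 0 T) r := by
      rw [derivWithin_of_mem_nhds (Icc_mem_nhds hr.1 hr'), derivWithin_of_mem_nhds (Icc_mem_nhds hr.1 (hr'.trans_le hs.2))]
    rw [e]
    have h := S.K2bound r ⟨hr.1.le, hr.2.trans hs.2⟩ 0
    have j0 : jap 0 = 1 := by simp [jap]
    rw [j0, Real.one_rpow, mul_one] at h
    exact h
  unfold c0
  have := abs_sub_abs_le_abs_sub (LL S s 0) (LL S 0 0)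
  linarith

theorem LL_bd (S : Setting γ T) {s : ℝ} (hs : s ∈ Set.Icc 0 T) (v : V3) :
    |LL S s v| ≤ (c0 S + S.K1 s) * jap v ^ (S.κ + 1) := by
  have hk : 0 ≤ S.κ := by linarith [S.hκ]
  have h1 := LL_zero_bd S hs
  have h2 := LL_lip S hs 0 v (jap v ^ S.κ) (by
    intro z hz
    refine Real.rpow_le_rpow (jap_pos z).le ?_ hk
    have hz' : ‖z‖ ≤ ‖v‖ := by
      obtain ⟨a, b, ha, hb, hab, rfl⟩ := hz
      simp only [smul_zero, zero_add, norm_smul, Real.norm_eq_abs, abs_of_nonneg hb]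
      nlinarith [norm_nonneg v]
    unfold jap
    gcongr)
  rw [sub_zero] at h2
  have h3 := norm_le_jap v
  have h4 : 1 ≤ jap v ^ (S.κ + 1) := Real.one_le_rpow (jap_ge_one v) (by linarith)
  have h5 : jap v ^ (S.κ + 1) = jap v ^ S.κ * jap v := by
    rw [Real.rpow_add (jap_pos v), Real.rpow_one]
  have h6 : S.K1 s * jap v ^ S.κ * ‖v‖ ≤ S.K1 s * jap v ^ (S.κ + 1) := by
    rw [h5, ← mul_assoc]
    have := mul_nonneg (S.K1nonneg s) (jap_rpow_pos S.κ v).le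
    gcongr
  have h7 := c0_nonneg S
  have := abs_sub_abs_le_abs_sub (LL S s v) (LL S s 0)
  nlinarith

/-- clamp -/
def clampT (T s : ℝ) : ℝ := max 0 (min s T)

theorem clampT_cont : Continuous (clampT T) := by unfold clampT; fun_prop
theorem clampT_mem (hT : 0 < T) (s : ℝ) : clampT T s ∈ Set.Icc 0 T :=
  ⟨le_max_left _ _, max_le hT.le (min_le_right _ _)⟩
theorem clampT_eq {s : ℝ} (hs : s ∈ Set.Icc 0 T) : clampT T s = s := by
  unfold clampT
  rw [min_eq_left hs.2, max_eq_right hs.1]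

theorem LLc_meas (S : Setting γ T) : Measurable (fun q : ℝ × V3 => LL S (clampT T q.1) q.2) := by
  refine measurable_uncurry_of_continuous_of_measurable (u := fun (s : ℝ) (w : V3) => LL S (clampT T s) w) ?_ ?_
  · intro w
    exact (LL_time S w).continuousOn.comp_continuous clampT_cont (clampT_mem S.hT)
  · intro s
    exact ((LL_vel S (clampT_mem S.hT s)).continuous).measurable

/-- time derivative of log g -/
def dLL (S : Setting γ T) (s : ℝ) (w : V3) : ℝ := derivWithin (fun r => LL S r w) (Set.Icc 0 T) s

theorem dLL_meas (S : Setting γ T) :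
    Measurable (fun q : ℝ × V3 => (Set.Ioo 0 T).indicator (fun s => dLL S s q.2) q.1) := by
  refine measurable_of_tendsto_metrizable (f := fun (n : ℕ) (q : ℝ × V3) =>
    (Set.Ioo 0 T).indicator (fun s => ((n:ℝ) + 1) * (LL S (clampT T (s + 1 / ((n:ℝ) + 1))) q.2 - LL S (clampT T s) q.2)) q.1) ?_ ?_
  · intro n
    have h := LLc_meas S
    have h1 : Measurable (fun q : ℝ × V3 => LL S (clampT T (q.1 + 1 / ((n:ℝ) + 1))) q.2) :=
      h.comp (f := fun q : ℝ × V3 => (q.1 + 1 / ((n:ℝ) + 1), q.2)) (by fun_prop)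
    exact ((h1.sub h).const_mul ((n:ℝ)+1)).indicator (measurable_fst measurableSet_Ioo)
  · rw [tendsto_pi_nhds]
    intro q
    by_cases hq : q.1 ∈ Set.Ioo 0 T
    · simp only [Set.indicator_of_mem hq]
      have hd : HasDerivAt (fun r => LL S r q.2) (dLL S q.1 q.2) q.1 := by
        have h := ((LL_time S q.2).differentiableOn (by norm_num) q.1 (Set.Ioo_subset_Icc_self hq)).hasDerivWithinAt
        exact h.hasDerivAt (Icc_mem_nhds hq.1 hq.2)
      have ht : Filter.Tendsto (fun n : ℕ => (1 : ℝ) / ((n:ℝ) + 1)) Filter.atTop (nhdsWithin 0 {0}ᶜ) := by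
        rw [tendsto_nhdsWithin_iff]
        refine ⟨tendsto_one_div_add_atTop_nhds_zero_nat, Filter.Eventually.of_forall fun n => ?_⟩
        simp
        positivity
      have h2 := (hasDerivAt_iff_tendsto_slope_zero.1 hd).comp ht
      refine h2.congr' ?_
      have ht' : Filter.Tendsto (fun n : ℕ => q.1 + (1 : ℝ) / ((n:ℝ) + 1)) Filter.atTop (nhds q.1) := by
        simpa using tendsto_one_div_add_atTop_nhds_zero_nat.const_add q.1
      filter_upwards [ht'.eventually (Icc_mem_nhds hq.1 hq.2)] with n hn
      simp only [Function.comp, smul_eq_mul]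
      rw [clampT_eq hn, clampT_eq (Set.Ioo_subset_Icc_self hq)]
      simp
    · simp only [Set.indicator_of_notMem hq]
      exact tendsto_const_nhds

theorem dLL_bd (S : Setting γ T) {s : ℝ} (hs : s ∈ Set.Icc 0 T) (v : V3) :
    |dLL S s v| ≤ S.K2 s * jap v ^ S.ν := S.K2bound s hs v

end

section
variable {γ T : ℝ} {S : Setting γ T} {F : ℝ × V3 → ℝ} {W : ℝ × (V3 × V3) → V3}

/-- identification of the third term -/
theorem third_eq (V : Ver S F W) (E : ℝ → V3 → V3) : ∀ᵐ s ∂(volume.restrict (Set.Ioc 0 T)),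
    (∫ p : V3 × V3, bilin (landauKernel γ (p.1 - p.2)) (E s p.1 - E s p.2)
              ((S.fGrad s p).1 - (S.fGrad s p).2) * Real.sqrt (S.f s p.1 * S.f s p.2)) =
    ∫ p : V3 × V3, ⟪E s p.1 - E s p.2, Theta γ F W (s, p)⟫ := by
  filter_upwards [V.Weq, ae_restrict_mem measurableSet_Ioc] with s hs hs'
  have hF := V.Feq s (Set.Ioc_subset_Icc_self hs')
  have h1 : ∀ᵐ p : V3 × V3, F (s, p.1) = S.f s p.1 := by
    rw [Measure.volume_eq_prod]
    exact Measure.quasiMeasurePreserving_fst.ae hF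
  have h2 : ∀ᵐ p : V3 × V3, F (s, p.2) = S.f s p.2 := by
    rw [Measure.volume_eq_prod]
    exact Measure.quasiMeasurePreserving_snd.ae hF
  apply integral_congr_ae
  filter_upwards [hs, h1, h2] with p hp hp1 hp2
  unfold Theta
  rw [← bilin_eq_inner]
  simp only
  rw [hp, hp1, hp2]

theorem AC_identity (V : Ver S F W) {ψ : V3 → ℝ} (hψ : ContDiff ℝ 2 ψ) (hc : HasCompactSupport ψ) :
    ∀ r ∈ Set.Icc 0 T, (∫ v, ψ v * F (r, v)) = (∫ v, ψ v * F (0, v)) -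
      ∫ s in (0:ℝ)..r, ∫ p : V3 × V3, ⟪gradient ψ p.1 - gradient ψ p.2, Theta γ F W (s, p)⟫ := by
  intro r hr
  have hT := S.hT
  let θ : ContDiffBump (0 : ℝ) := ⟨T + 1, T + 2, by linarith, by linarith⟩
  have hθ1 : ∀ s ∈ Set.Icc 0 T, ∀ᶠ x in nhds s, θ x = 1 := by
    intro s hs
    have : Metric.ball (0:ℝ) (T + 1) ∈ nhds s := by
      apply Metric.isOpen_ball.mem_nhds
      rw [mem_ball_zero_iff, Real.norm_eq_abs, abs_of_nonneg hs.1]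
      linarith [hs.2]
    filter_upwards [this] with x hx
    exact θ.one_of_mem_closedBall (Metric.ball_subset_closedBall hx)
  have hθ2 : ∀ s ∈ Set.Icc 0 T, θ s = 1 := fun s hs => (hθ1 s hs).self_of_nhds
  have hw := S.hf.weakForm (fun t v => θ t * ψ v) ?_ ?_ r hr
  · have h0 : (0:ℝ) ∈ Set.Icc 0 T := ⟨le_rfl, hT.le⟩
    have e1 : ∀ r ∈ Set.Icc 0 T, (∫ v, θ r * ψ v * S.f r v) = ∫ v, ψ v * F (r, v) := by
      intro r hr
      apply integral_congr_ae
      filter_upwards [V.Feq r hr] with v hv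
      rw [hv, hθ2 r hr, one_mul]
    rw [e1 r hr, e1 0 h0] at hw
    have e2 : (∫ s in (0 : ℝ)..r, ∫ v, deriv (fun r => θ r * ψ v) s * S.f s v) = 0 := by
      have : ∀ s ∈ Set.uIcc 0 r, (∫ v, deriv (fun r => θ r * ψ v) s * S.f s v) = 0 := by
        intro s hs
        rw [Set.uIcc_of_le hr.1] at hs
        have hs' : s ∈ Set.Icc 0 T := ⟨hs.1, hs.2.trans hr.2⟩
        have : ∀ v, deriv (fun r => θ r * ψ v) s = 0 := by
          intro v
          have : (fun r => θ r * ψ v) =ᶠ[nhds s] fun _ => ψ v := by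
            filter_upwards [hθ1 s hs'] with x hx
            rw [hx, one_mul]
          rw [this.deriv_eq, deriv_const]
        simp [this]
      rw [intervalIntegral.integral_congr this]
      simp
    have e3 : (∫ s in (0 : ℝ)..r, ∫ p : V3 × V3,
            bilin (landauKernel γ (p.1 - p.2))
              (gradient ((fun t v => θ t * ψ v) s) p.1 - gradient ((fun t v => θ t * ψ v) s) p.2)
              ((S.fGrad s p).1 - (S.fGrad s p).2) * Real.sqrt (S.f s p.1 * S.f s p.2)) = 
              ∫ s in (0:ℝ)..r, ∫ p : V3 × V3, ⟪gradient ψ p.1 - gradient ψ p.2, Theta γ F W (s, p)⟫ := by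
      rw [intervalIntegral.integral_of_le hr.1, intervalIntegral.integral_of_le hr.1]
      apply integral_congr_ae
      have h3 := ae_restrict_of_ae_restrict_of_subset (Set.Ioc_subset_Ioc_right hr.2) (third_eq V (fun _ => gradient ψ))
      filter_upwards [h3, ae_restrict_mem measurableSet_Ioc] with s hs hs'
      rw [← hs]
      have : (fun v => θ s * ψ v) = ψ := by
        ext v
        rw [hθ2 s ⟨hs'.1.le, hs'.2.trans hr.2⟩, one_mul]
      simp only [this]
    rw [e2, e3] at hw
    linarith
  · exact (θ.contDiff.comp contDiff_fst).mul (hψ.comp contDiff_snd)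
  · refine HasCompactSupport.intro (K := tsupport θ ×ˢ tsupport ψ) (θ.hasCompactSupport.isCompact.prod hc.isCompact) ?_
    intro q hq
    by_cases h1 : q.1 ∈ tsupport θ
    · have h2 : q.2 ∉ tsupport ψ := fun h2 => hq ⟨h1, h2⟩
      simp [image_eq_zero_of_notMem_tsupport h2]
    · simp [image_eq_zero_of_notMem_tsupport h1]

theorem lip_dom (V : Ver S F W) {c : ℝ → ℝ} {M : ℝ} (hM : 0 ≤ M) (s : ℝ) (p : V3 × V3) 
    (hcM : 16 * M ^ 2 ≤ c s) {e e' : V3}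
    (h1 : ‖e‖ ≤ M) (h1' : ‖e'‖ ≤ M) (h2 : ‖e - e'‖ ≤ M * ‖p.1 - p.2‖) :
    ‖(⟪e - e', Theta γ F W (s, p)⟫ : ℝ)‖ ≤ Dom S F W c (s, p) := by
  have hj : 1 ≤ max (jap p.1) (jap p.2) := (jap_ge_one _).trans (le_max_left _ _)
  refine inner_Theta_le V (s, p) (e - e') (2 * M) (by positivity) (by simp only; linarith) ?_ ?_
  · have : 1 ≤ (max (jap p.1) (jap p.2)) ^ S.κ := Real.one_le_rpow hj (by linarith [S.hκ])
    have := norm_sub_le e e'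
    nlinarith
  · intro _
    have h : 1 ≤ (max (jap p.1) (jap p.2)) ^ (max S.κ S.ζ) :=
      Real.one_le_rpow hj (le_max_of_le_left (by linarith [S.hκ]))
    have h3 := mul_nonneg hM (norm_nonneg (p.1 - p.2))
    simp only
    nlinarith
end

theorem fub_triple {X Y Z : Type*} [MeasurableSpace X] [MeasurableSpace Y] [MeasurableSpace Z]
    (lam : Measure X) (μ : Measure Y) (ν : Measure Z) [SFinite lam] [SFinite μ] [SFinite ν]
    (h : X → Y → Z → ℝ)
    (hi : Integrable (fun q : X × (Y × Z) => h q.1 q.2.1 q.2.2) (lam.prod (μ.prod ν))) :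
    Integrable (fun w => ∫ s, ∫ x, h w s x ∂ν ∂μ) lam ∧
    ∫ w, ∫ s, ∫ x, h w s x ∂ν ∂μ ∂lam = ∫ s, ∫ x, ∫ w, h w s x ∂lam ∂ν ∂μ := by
  have h1 : (fun w => ∫ y : Y × Z, h w y.1 y.2 ∂(μ.prod ν)) =ᵐ[lam] fun w => ∫ s, ∫ x, h w s x ∂ν ∂μ := by
    filter_upwards [hi.prod_right_ae] with w hw
    rw [integral_prod _ hw]
  refine ⟨(integrable_congr h1).1 hi.integral_prod_left, ?_⟩
  rw [← integral_congr_ae h1, ← integral_prod (fun y : Y × Z => ∫ w, h w y.1 y.2 ∂lam) hi.integral_prod_right]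
  rw [integral_integral_swap]
  exact hi

/-- test function family -/
def psi (η χ : V3 → ℝ) (w v : V3) : ℝ := η (v - w) * χ v
/-- its gradient -/
def EE (η χ : V3 → ℝ) (w v : V3) : V3 := χ v • gradient η (v - w) + η (v - w) • gradient χ v

section
variable {η χ : V3 → ℝ}

theorem psi_grad (hη : ContDiff ℝ 2 η) (hχ : ContDiff ℝ 2 χ) (w v : V3) :
    HasGradientAt (psi η χ w) (EE η χ w v) v := by
  have h1 : HasFDerivAt (fun v => η (v - w)) (fderiv ℝ η (v - w)) v := by
    have := (hη.differentiable (by norm_num) (v - w)).hasFDerivAt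
    have h := HasFDerivAt.comp v this ((hasFDerivAt_id v).sub_const w)
    rw [ContinuousLinearMap.comp_id] at h
    exact h
  have h2 := (hχ.differentiable (by norm_num) v).hasFDerivAt
  have h3 := h1.mul h2
  rw [hasGradientAt_iff_hasFDerivAt]
  refine h3.congr_fderiv ?_
  unfold EE gradient
  simp [add_comm]

theorem psi_cont (hη : ContDiff ℝ 2 η) (hχ : ContDiff ℝ 2 χ) :
    Continuous (fun q : V3 × V3 => psi η χ q.1 q.2) := by
  have := hη.continuous
  have := hχ.continuous
  unfold psi
  fun_prop

theorem EE_cont (hη : ContDiff ℝ 2 η) (hχ : ContDiff ℝ 2 χ) :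
    Continuous (fun q : V3 × V3 => EE η χ q.1 q.2) := by
  have := hη.continuous
  have := hχ.continuous
  have := gradient_continuous (hη.of_le (by norm_num))
  have := gradient_continuous (hχ.of_le (by norm_num))
  unfold EE
  fun_prop

theorem grad_hcs {h : V3 → ℝ} (hc : HasCompactSupport h) : HasCompactSupport (gradient h) := by
  refine (hc.fderiv ℝ).comp_left (g := (InnerProductSpace.toDual ℝ V3).symm) (map_zero _)

theorem cc_bd {E : Type*} [NormedAddCommGroup E] [NormedSpace ℝ E] {h : V3 → E} (hh : ContDiff ℝ 1 h) (hc : HasCompactSupport h) :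
    ∃ M, 0 ≤ M ∧ (∀ v, ‖h v‖ ≤ M) ∧ ∀ v v', ‖h v - h v'‖ ≤ M * ‖v - v'‖ := by
  obtain ⟨M1, h1⟩ := hc.exists_bound_of_continuous hh.continuous
  obtain ⟨M2, h2⟩ := hh.lipschitzWith_of_hasCompactSupport hc (by norm_num)
  refine ⟨max (max M1 0) M2, by positivity, fun v => (h1 v).trans (by simp), fun v v' => ?_⟩
  have := h2.dist_le_mul v v'
  rw [dist_eq_norm, dist_eq_norm] at this
  exact this.trans (by gcongr; simp)

theorem hcs_ball {h : V3 → ℝ} (hc : HasCompactSupport h) : ∃ R, 0 ≤ R ∧ ∀ v, R < ‖v‖ → h v = 0 ∧ gradient h v = 0 := by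
  obtain ⟨R, hR⟩ := hc.isCompact.isBounded.subset_closedBall 0
  refine ⟨max R 0, by positivity, fun v hv => ?_⟩
  have : v ∉ tsupport h := by
    intro hm
    have := hR hm
    rw [mem_closedBall_zero_iff] at this
    have := le_max_left R 0
    linarith
  refine ⟨image_eq_zero_of_notMem_tsupport this, ?_⟩
  have h2 : v ∉ tsupport (gradient h) := by
    intro hm
    apply this
    refine (tsupport_comp_subset (map_zero (InnerProductSpace.toDual ℝ V3).symm) (fderiv ℝ h)).trans ?_ hm
    exact tsupport_fderiv_subset ℝ
  exact image_eq_zero_of_notMem_tsupport h2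

theorem EE_bounds (hη : ContDiff ℝ 2 η) (hχ : ContDiff ℝ 2 χ) (cη : HasCompactSupport η) (cχ : HasCompactSupport χ) :
    ∃ M R, 0 ≤ M ∧ 0 ≤ R ∧ (∀ w v, ‖EE η χ w v‖ ≤ M) ∧ (∀ w v v', ‖EE η χ w v - EE η χ w v'‖ ≤ M * ‖v - v'‖) ∧
      (∀ w v, |psi η χ w v| ≤ M) ∧ (∀ w v, R < ‖w‖ → EE η χ w v = 0 ∧ psi η χ w v = 0) := by
  obtain ⟨M1, m1, b1, l1⟩ := cc_bd (hη.of_le (by norm_num)) cη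
  obtain ⟨M2, m2, b2, l2⟩ := cc_bd (hχ.of_le (by norm_num)) cχ
  obtain ⟨M3, m3, b3, l3⟩ := cc_bd (gradient_contDiff (n := 1) (h := η) (by convert hη using 1; norm_num)) (grad_hcs cη)
  obtain ⟨M4, m4, b4, l4⟩ := cc_bd (gradient_contDiff (n := 1) (h := χ) (by convert hχ using 1; norm_num)) (grad_hcs cχ)
  obtain ⟨R1, r1, z1⟩ := hcs_ball cη
  obtain ⟨R2, r2, z2⟩ := hcs_ball cχ
  refine ⟨2 * M2 * M3 + 2 * M1 * M4 + M1 * M2, R1 + R2, by positivity, by positivity, ?_, ?_, ?_, ?_⟩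
  · intro w v
    unfold EE
    have e1 : ‖χ v • gradient η (v - w)‖ ≤ M2 * M3 := by
      rw [norm_smul]; exact mul_le_mul (b2 _) (b3 _) (norm_nonneg _) m2
    have e2 : ‖η (v - w) • gradient χ v‖ ≤ M1 * M4 := by
      rw [norm_smul]; exact mul_le_mul (b1 _) (b4 _) (norm_nonneg _) m1
    have := norm_add_le (χ v • gradient η (v - w)) (η (v - w) • gradient χ v)
    have := mul_nonneg m1 m2
    have := mul_nonneg m2 m3
    have := mul_nonneg m1 m4
    linarith
  · intro w v v'
    have e : EE η χ w v - EE η χ w v' = χ v • (gradient η (v - w) - gradient η (v' - w)) + (χ v - χ v') • gradient η (v' - w)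
      + (η (v - w) • (gradient χ v - gradient χ v') + (η (v - w) - η (v' - w)) • gradient χ v') := by
      unfold EE
      simp only [smul_sub, sub_smul]
      abel
    have hz : ‖(v - w) - (v' - w)‖ = ‖v - v'‖ := by congr 1; abel
    rw [e]
    have e1 : ‖χ v • (gradient η (v - w) - gradient η (v' - w))‖ ≤ M2 * (M3 * ‖v - v'‖) := by
      rw [norm_smul, ← hz]; exact mul_le_mul (b2 _) (l3 _ _) (norm_nonneg _) m2
    have e2 : ‖(χ v - χ v') • gradient η (v' - w)‖ ≤ M2 * ‖v - v'‖ * M3 := by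
      rw [norm_smul]; exact mul_le_mul (l2 _ _) (b3 _) (norm_nonneg _) (by positivity)
    have e3 : ‖η (v - w) • (gradient χ v - gradient χ v')‖ ≤ M1 * (M4 * ‖v - v'‖) := by
      rw [norm_smul]; exact mul_le_mul (b1 _) (l4 _ _) (norm_nonneg _) m1
    have e4 : ‖(η (v - w) - η (v' - w)) • gradient χ v'‖ ≤ M1 * ‖v - v'‖ * M4 := by
      rw [norm_smul, ← hz]; exact mul_le_mul (l1 _ _) (b4 _) (norm_nonneg _) (by positivity)
    refine (norm_add_le_of_le (norm_add_le_of_le e1 e2) (norm_add_le_of_le e3 e4)).trans ?_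
    have : 0 ≤ M1 * M2 * ‖v - v'‖ := by positivity
    linarith
  · intro w v
    unfold psi
    rw [abs_mul]
    have := mul_le_mul (b1 (v - w)) (b2 v) (norm_nonneg _) m1
    rw [Real.norm_eq_abs, Real.norm_eq_abs] at this
    have := mul_nonneg m2 m3
    have := mul_nonneg m1 m4
    linarith
  · intro w v hw
    unfold EE psi
    by_cases h : R2 < ‖v‖
    · simp [(z2 v h).1, (z2 v h).2]
    · have : R1 < ‖v - w‖ := by
        have := norm_sub_norm_le w v
        rw [norm_sub_rev] at this
        linarith
      simp [(z1 _ this).1, (z1 _ this).2]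

end

section
variable {γ T : ℝ} {S : Setting γ T} {F : ℝ × V3 → ℝ} {W : ℝ × (V3 × V3) → V3}
variable {η χ : V3 → ℝ}

/-- smoothed log g -/
def Phi (S : Setting γ T) (η χ : V3 → ℝ) (s : ℝ) (v : V3) : ℝ := ∫ w, LL S s w * psi η χ w v
/-- smoothed time derivative -/
def dPhi (S : Setting γ T) (η χ : V3 → ℝ) (s : ℝ) (v : V3) : ℝ := ∫ w, dLL S s w * psi η χ w v
/-- smoothed gradient -/
def Dn (S : Setting γ T) (η χ : V3 → ℝ) (s : ℝ) (v : V3) : V3 := ∫ w, LL S s w • EE η χ w v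

theorem jap_ball_bd {a R : ℝ} (ha : 0 ≤ a) {w : V3} (hw : ‖w‖ ≤ R) : jap w ^ a ≤ (1 + R) ^ a := by
  refine Real.rpow_le_rpow (jap_pos w).le ?_ ha
  have := jap_le_one_add w
  linarith

theorem ball_ind_integrable (R : ℝ) : Integrable ((Metric.closedBall (0:V3) R).indicator (fun _ => (1:ℝ))) :=
  (integrable_indicator_iff measurableSet_closedBall).2 
    (integrableOn_const (isCompact_closedBall 0 R).measure_lt_top.ne (by simp))

theorem term1 (V : Ver S F W) (hη : ContDiff ℝ 2 η) (hχ : ContDiff ℝ 2 χ) (cη : HasCompactSupport η) (cχ : HasCompactSupport χ)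
    {t : ℝ} (ht : t ∈ Set.Icc 0 T) :
    Integrable (fun w => LL S t w * ∫ v, psi η χ w v * F (t, v)) ∧
    ∫ w, LL S t w * ∫ v, psi η χ w v * F (t, v) = ∫ v, Phi S η χ t v * F (t, v) := by
  obtain ⟨M, R, hM, hR, b1, b2, b3, b4⟩ := EE_bounds hη hχ cη cχ
  have hk : 0 ≤ S.κ + 1 := by linarith [S.hκ]
  have hFi := (F_mom V ht).2.2.1
  have hFm := V.Fm
  have hLm := (LL_vel S ht).continuous.measurable
  have hpm := (psi_cont hη hχ).measurable
  have hi : Integrable (fun q : V3 × V3 => LL S t q.1 * (psi η χ q.1 q.2 * F (t, q.2))) (volume.prod volume) := by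
    refine Integrable.mono' (((ball_ind_integrable R).mul_prod hFi).const_mul ((c0 S + S.K1 t) * (1 + R) ^ (S.κ + 1) * M)) ?_ ?_
    · exact Measurable.aestronglyMeasurable (by fun_prop)
    · refine Filter.Eventually.of_forall fun q => ?_
      by_cases hq : q.1 ∈ Metric.closedBall (0:V3) R
      · rw [Set.indicator_of_mem hq]
        rw [mem_closedBall_zero_iff] at hq
        rw [norm_mul, norm_mul, one_mul, Real.norm_eq_abs, Real.norm_eq_abs, Real.norm_eq_abs, abs_of_nonneg (V.F0 _), mul_assoc]
        have h1 := (LL_bd S ht q.1).trans (mul_le_mul_of_nonneg_left (jap_ball_bd hk hq) (add_nonneg (c0_nonneg S) (S.K1nonneg t)))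
        have h2 := V.F0 (t, q.2)
        have h3 := b3 q.1 q.2
        have := c0_nonneg S
        have := S.K1nonneg t
        gcongr
      · rw [Set.indicator_of_notMem hq]
        rw [mem_closedBall_zero_iff, not_le] at hq
        simp [(b4 q.1 q.2 hq).2]
  constructor
  · have := hi.integral_prod_left
    simpa only [integral_const_mul] using this
  · have h := integral_integral_swap (f := fun w v => LL S t w * (psi η χ w v * F (t, v))) hi
    simp only [integral_const_mul] at h
    rw [h]
    congr 1
    ext v
    rw [Phi, ← integral_mul_const]
    congr 1
    ext w
    ring

theorem term2 (V : Ver S F W) (hη : ContDiff ℝ 2 η) (hχ : ContDiff ℝ 2 χ) (cη : HasCompactSupport η) (cχ : HasCompactSupport χ)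
    {t : ℝ} (ht : t ∈ Set.Icc 0 T) :
    Integrable (fun w => ∫ s in (0:ℝ)..t, derivWithin (fun r => LL S r w) (Set.Icc 0 t) s * ∫ v, psi η χ w v * F (s, v)) ∧
    ∫ w, ∫ s in (0:ℝ)..t, derivWithin (fun r => LL S r w) (Set.Icc 0 t) s * ∫ v, psi η χ w v * F (s, v) = 
      ∫ s in (0:ℝ)..t, ∫ v, dPhi S η χ s v * F (s, v) := by
  obtain ⟨M, R, hM, hR, b1, b2, b3, b4⟩ := EE_bounds hη hχ cη cχ
  have hn : 0 ≤ S.ν := by linarith [S.hν]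
  have hFm := V.Fm
  have hpm := (psi_cont hη hχ).measurable
  have hdm := dLL_meas S
  have hK2m := S.K2meas
  set D : ℝ → V3 → ℝ := fun s w => (Set.Ioo 0 T).indicator (fun s => dLL S s w) s with hD
  have hsub : Set.Ioc 0 t ⊆ Set.Ioc 0 T := Set.Ioc_subset_Ioc_right ht.2
  have hKF : Integrable (fun q : ℝ × V3 => S.K2 q.1 * F q) ((volume.restrict (Set.Ioc 0 t)).prod volume) := by
    rw [integrable_prod_iff (Measurable.aestronglyMeasurable (by fun_prop))]
    constructor
    · filter_upwards [ae_restrict_mem measurableSet_Ioc] with s hs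
      exact (F_mom V (Set.Ioc_subset_Icc_self (hsub hs))).2.2.1.const_mul _
    · refine ((Kint_facts S).1.mono_set hsub).congr ?_
      filter_upwards [ae_restrict_mem measurableSet_Ioc] with s hs
      have h4 := (F_mom V (Set.Ioc_subset_Icc_self (hsub hs))).2.2.2
      simp only [norm_mul, integral_const_mul, Real.norm_eq_abs, abs_of_nonneg (S.K2nonneg _), abs_of_nonneg (V.F0 _)]
      rw [h4, mul_one]
  have hi : Integrable (fun q : V3 × (ℝ × V3) => D q.2.1 q.1 * (psi η χ q.1 q.2.2 * F (q.2.1, q.2.2))) 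
      (volume.prod ((volume.restrict (Set.Ioc 0 t)).prod volume)) := by
    refine Integrable.mono' (((ball_ind_integrable R).mul_prod hKF).const_mul ((1 + R) ^ S.ν * M)) ?_ ?_
    · refine AEStronglyMeasurable.mul ?_ (Measurable.aestronglyMeasurable (by fun_prop))
      exact (hdm.comp (f := fun q : V3 × (ℝ × V3) => (q.2.1, q.1)) (by fun_prop)).aestronglyMeasurable
    · refine Filter.Eventually.of_forall fun q => ?_
      by_cases hq : q.1 ∈ Metric.closedBall (0:V3) R
      · rw [Set.indicator_of_mem hq]
        rw [mem_closedBall_zero_iff] at hq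
        have h0 : |D q.2.1 q.1| ≤ S.K2 q.2.1 * (1 + R) ^ S.ν := by
          have hp := mul_nonneg (S.K2nonneg q.2.1) (Real.rpow_nonneg (by linarith : 0 ≤ 1 + R) S.ν)
          by_cases hs : q.2.1 ∈ Set.Ioo 0 T
          · simp only [hD, Set.indicator_of_mem hs]
            exact (dLL_bd S (Set.Ioo_subset_Icc_self hs) q.1).trans (mul_le_mul_of_nonneg_left (jap_ball_bd hn hq) (S.K2nonneg _))
          · simp only [hD, Set.indicator_of_notMem hs, abs_zero]
            exact hp
        rw [norm_mul, norm_mul, one_mul, Real.norm_eq_abs, Real.norm_eq_abs, Real.norm_eq_abs, abs_of_nonneg (V.F0 _)]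
        have h2 := V.F0 q.2
        have h3 := b3 q.1 q.2.2
        have := S.K2nonneg q.2.1
        have := abs_nonneg (psi η χ q.1 q.2.2)
        calc |D q.2.1 q.1| * (|psi η χ q.1 q.2.2| * F q.2) ≤ (S.K2 q.2.1 * (1 + R) ^ S.ν) * (M * F q.2) := by gcongr
          _ = _ := by ring
      · rw [Set.indicator_of_notMem hq]
        rw [mem_closedBall_zero_iff, not_le] at hq
        simp [(b4 q.1 q.2.2 hq).2]
  have h := fub_triple volume (volume.restrict (Set.Ioc 0 t)) volume (fun w s v => D s w * (psi η χ w v * F (s, v))) hi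
  have hne : ∀ᵐ r ∂(volume.restrict (Set.Ioc 0 t)), r ≠ t := ae_restrict_of_ae (Measure.ae_ne volume t)
  have e1 : ∀ w, (∫ s in (0:ℝ)..t, derivWithin (fun r => LL S r w) (Set.Icc 0 t) s * ∫ v, psi η χ w v * F (s, v)) =
      ∫ s in Set.Ioc 0 t, ∫ v, D s w * (psi η χ w v * F (s, v)) := by
    intro w
    rw [intervalIntegral.integral_of_le ht.1]
    apply integral_congr_ae
    filter_upwards [ae_restrict_mem measurableSet_Ioc, hne] with s hs hs'
    have hst : s < t := lt_of_le_of_ne hs.2 hs'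
    rw [integral_const_mul]
    congr 1
    rw [hD]
    simp only [Set.indicator_of_mem (show s ∈ Set.Ioo 0 T from ⟨hs.1, hst.trans_le ht.2⟩)]
    rw [dLL, derivWithin_of_mem_nhds (Icc_mem_nhds hs.1 hst), derivWithin_of_mem_nhds (Icc_mem_nhds hs.1 (hst.trans_le ht.2))]
  simp only [e1]
  refine ⟨h.1, h.2.trans ?_⟩
  rw [intervalIntegral.integral_of_le ht.1]
  apply integral_congr_ae
  filter_upwards [ae_restrict_mem measurableSet_Ioc, hne] with s hs hs'
  have hst : s < t := lt_of_le_of_ne hs.2 hs'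
  congr 1
  ext v
  rw [dPhi, ← integral_mul_const]
  congr 1
  ext w
  rw [hD]
  simp only [Set.indicator_of_mem (show s ∈ Set.Ioo 0 T from ⟨hs.1, hst.trans_le ht.2⟩)]
  ring

theorem sq_int (S : Setting γ T) (a b : ℝ) : IntegrableOn (fun s => a * (b + S.K1 s) ^ 2) (Set.Ioc 0 T) := by
  have h1 := (Kint_facts S).2.1
  have hm := S.K1meas
  have hb : IntegrableOn (fun s => 2 * b ^ 2 + 2 * S.K1 s ^ 2) (Set.Ioc 0 T) :=
    (integrableOn_const (by simp) enorm_ne_top).add (h1.const_mul 2)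
  refine Integrable.const_mul ?_ a
  refine Integrable.mono' hb (Measurable.aestronglyMeasurable (by fun_prop)) (Filter.Eventually.of_forall fun s => ?_)
  rw [Real.norm_eq_abs, abs_of_nonneg (sq_nonneg _)]
  nlinarith [sq_nonneg (b - S.K1 s)]

theorem LE_integrable (hη : ContDiff ℝ 2 η) (hχ : ContDiff ℝ 2 χ) (cη : HasCompactSupport η) (cχ : HasCompactSupport χ) 
    {s : ℝ} (hs : s ∈ Set.Icc 0 T) (v : V3) : Integrable (fun w => LL S s w • EE η χ w v) := by
  obtain ⟨M, R, hM, hR, b1, b2, b3, b4⟩ := EE_bounds hη hχ cη cχ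
  have h1 := (LL_vel S hs).continuous
  have h2 : Continuous fun w => EE η χ w v := (EE_cont hη hχ).comp (f := fun w => (w, v)) (by fun_prop)
  refine (h1.smul h2).integrable_of_hasCompactSupport ?_
  refine HasCompactSupport.intro (isCompact_closedBall (0:V3) R) fun w hw => ?_
  rw [mem_closedBall_zero_iff, not_le] at hw
  simp [(b4 w v hw).1]

theorem term3 (V : Ver S F W) (hη : ContDiff ℝ 2 η) (hχ : ContDiff ℝ 2 χ) (cη : HasCompactSupport η) (cχ : HasCompactSupport χ)
    {t : ℝ} (ht : t ∈ Set.Icc 0 T) :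
    Integrable (fun w => ∫ s in (0:ℝ)..t, LL S s w * ∫ p : V3 × V3, ⟪EE η χ w p.1 - EE η χ w p.2, Theta γ F W (s, p)⟫) ∧
    ∫ w, ∫ s in (0:ℝ)..t, LL S s w * ∫ p : V3 × V3, ⟪EE η χ w p.1 - EE η χ w p.2, Theta γ F W (s, p)⟫ = 
      ∫ s in (0:ℝ)..t, ∫ p : V3 × V3, ⟪Dn S η χ s p.1 - Dn S η χ s p.2, Theta γ F W (s, p)⟫ := by
  obtain ⟨M, R, hM, hR, b1, b2, b3, b4⟩ := EE_bounds hη hχ cη cχ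
  have hk : 0 ≤ S.κ + 1 := by linarith [S.hκ]
  have hEm := (EE_cont hη hχ).measurable
  have hLm := LLc_meas S
  have hTm := Theta_meas V
  have hsub : Set.Ioc 0 t ⊆ Set.Ioc 0 T := Set.Ioc_subset_Ioc_right ht.2
  set B : ℝ := (1 + R) ^ (S.κ + 1) * M with hB
  have hB0 : 0 ≤ B := mul_nonneg (Real.rpow_nonneg (by linarith) _) hM
  set c : ℝ → ℝ := fun s => (16 * B ^ 2) * (c0 S + S.K1 s) ^ 2 with hc
  have hdom := Dom_integrable V (c := c) (fun s => by positivity) (sq_int S _ _)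
  have hdom' : Integrable (Dom S F W c) ((volume.restrict (Set.Ioc 0 t)).prod volume) :=
    hdom.mono_measure (Measure.prod_mono (Measure.restrict_mono hsub le_rfl) le_rfl)
  have hi : Integrable (fun q : V3 × (ℝ × (V3 × V3)) => LL S (clampT T q.2.1) q.1 * ⟪EE η χ q.1 q.2.2.1 - EE η χ q.1 q.2.2.2, Theta γ F W (q.2.1, q.2.2)⟫) 
      (volume.prod ((volume.restrict (Set.Ioc 0 t)).prod volume)) := by
    refine Integrable.mono' ((ball_ind_integrable R).mul_prod hdom') ?_ ?_
    · refine AEStronglyMeasurable.mul ?_ (Measurable.aestronglyMeasurable (Measurable.inner (by fun_prop) (by fun_prop)))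
      exact (hLm.comp (f := fun q : V3 × (ℝ × (V3 × V3)) => (q.2.1, q.1)) (by fun_prop)).aestronglyMeasurable
    · have : ∀ᵐ q ∂((volume : Measure V3).prod ((volume.restrict (Set.Ioc 0 t)).prod (volume : Measure (V3 × V3)))), q.2.1 ∈ Set.Ioc 0 t := by
        have h1 : ∀ᵐ q ∂((volume.restrict (Set.Ioc 0 t)).prod (volume : Measure (V3 × V3))), q.1 ∈ Set.Ioc 0 t :=
          Measure.quasiMeasurePreserving_fst.ae (ae_restrict_mem measurableSet_Ioc)
        exact Measure.quasiMeasurePreserving_snd.ae h1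
      filter_upwards [this] with q hs
      have hs := Set.Ioc_subset_Icc_self (hsub hs)
      rw [clampT_eq hs]
      by_cases hq : q.1 ∈ Metric.closedBall (0:V3) R
      · rw [Set.indicator_of_mem hq, one_mul]
        rw [mem_closedBall_zero_iff] at hq
        have h1 := (LL_bd S hs q.1).trans (mul_le_mul_of_nonneg_left (jap_ball_bd hk hq) (add_nonneg (c0_nonneg S) (S.K1nonneg _)))
        rw [← real_inner_smul_left, smul_sub]
        have hcK : 0 ≤ c0 S + S.K1 q.2.1 := add_nonneg (c0_nonneg S) (S.K1nonneg _)
        have hr : 0 ≤ (1 + R) ^ (S.κ + 1) := Real.rpow_nonneg (by linarith) _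
        have hE : ∀ x, ‖LL S q.2.1 q.1 • EE η χ q.1 x‖ ≤ (c0 S + S.K1 q.2.1) * B := by
          intro x
          rw [norm_smul, hB, ← mul_assoc]
          exact mul_le_mul h1 (b1 _ _) (norm_nonneg _) (mul_nonneg hcK hr)
        refine lip_dom V (M := (c0 S + S.K1 q.2.1) * B) (mul_nonneg hcK hB0) q.2.1 q.2.2 ?_ (hE _) (hE _) ?_
        · rw [hc]
          apply le_of_eq
          ring
        · rw [← smul_sub, norm_smul, hB, ← mul_assoc, mul_assoc _ M]
          exact mul_le_mul h1 (b2 _ _ _) (norm_nonneg _) (mul_nonneg hcK hr)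
      · rw [Set.indicator_of_notMem hq]
        rw [mem_closedBall_zero_iff, not_le] at hq
        simp [(b4 q.1 q.2.2.1 hq).1, (b4 q.1 q.2.2.2 hq).1]
  have h := fub_triple volume (volume.restrict (Set.Ioc 0 t)) volume (fun w s p => LL S (clampT T s) w * ⟪EE η χ w p.1 - EE η χ w p.2, Theta γ F W (s, p)⟫) hi
  have e1 : ∀ w, (∫ s in (0:ℝ)..t, LL S s w * ∫ p : V3 × V3, ⟪EE η χ w p.1 - EE η χ w p.2, Theta γ F W (s, p)⟫) =
      ∫ s in Set.Ioc 0 t, ∫ p : V3 × V3, LL S (clampT T s) w * ⟪EE η χ w p.1 - EE η χ w p.2, Theta γ F W (s, p)⟫ := by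
    intro w
    rw [intervalIntegral.integral_of_le ht.1]
    apply setIntegral_congr_fun measurableSet_Ioc
    intro s hs
    simp only
    rw [integral_const_mul, clampT_eq (Set.Ioc_subset_Icc_self (hsub hs))]
  simp only [e1]
  refine ⟨h.1, h.2.trans ?_⟩
  rw [intervalIntegral.integral_of_le ht.1]
  apply setIntegral_congr_fun measurableSet_Ioc
  intro s hs
  have hs := Set.Ioc_subset_Icc_self (hsub hs)
  simp only [clampT_eq hs]
  congr 1
  ext p
  have i1 := LE_integrable (S := S) hη hχ cη cχ hs p.1
  have i2 := LE_integrable (S := S) hη hχ cη cχ hs p.2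
  rw [Dn, Dn, ← integral_sub i1 i2, real_inner_comm, ← integral_inner (f := fun w => LL S s w • EE η χ w p.1 - LL S s w • EE η χ w p.2) (i1.sub i2)]
  congr 1
  ext w
  rw [real_inner_comm, ← smul_sub, real_inner_smul_right]

theorem approx_identity (V : Ver S F W) (hη : ContDiff ℝ 2 η) (hχ : ContDiff ℝ 2 χ) (cη : HasCompactSupport η) (cχ : HasCompactSupport χ)
    {t : ℝ} (ht : t ∈ Set.Icc 0 T) :
    (∫ v, Phi S η χ t v * F (t, v)) - ∫ v, Phi S η χ 0 v * F (0, v) = 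
      (∫ s in (0:ℝ)..t, ∫ v, dPhi S η χ s v * F (s, v)) - 
      ∫ s in (0:ℝ)..t, ∫ p : V3 × V3, ⟪Dn S η χ s p.1 - Dn S η χ s p.2, Theta γ F W (s, p)⟫ := by
  obtain ⟨M, R, hM, hR, b1, b2, b3, b4⟩ := EE_bounds hη hχ cη cχ
  have h0 : (0:ℝ) ∈ Set.Icc 0 T := ⟨le_rfl, S.hT.le⟩
  have hsub : Set.Ioc 0 t ⊆ Set.Ioc 0 T := Set.Ioc_subset_Ioc_right ht.2
  have i1 := term1 V hη hχ cη cχ ht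
  have i2 := term1 V hη hχ cη cχ h0
  have i3 := term2 V hη hχ cη cχ ht
  have i4 := term3 V hη hχ cη cχ ht
  rw [← i1.2, ← i2.2, ← i3.2, ← i4.2, ← integral_sub i1.1 i2.1, ← integral_sub i3.1 i4.1]
  congr 1
  ext w
  have hψ : ContDiff ℝ 2 (psi η χ w) := (hη.comp (contDiff_id.sub contDiff_const)).mul hχ
  have hgr : gradient (psi η χ w) = EE η χ w := by
    ext1 v
    exact (psi_grad hη hχ w v).gradient
  have hac := AC_identity V hψ cχ.mul_left
  rw [hgr] at hac
  refine product_rule_aux ht.1 (fun r => LL S r w) (fun r => ∫ v, psi η χ w v * F (r, v))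
    (fun s => ∫ p : V3 × V3, ⟪EE η χ w p.1 - EE η χ w p.2, Theta γ F W (s, p)⟫)
    ((LL_time S w).mono (Set.Icc_subset_Icc_right ht.2)) ?_ (fun r hr => hac r ⟨hr.1, hr.2.trans ht.2⟩)
  rw [intervalIntegrable_iff_integrableOn_Ioc_of_le ht.1]
  have hdom := Dom_integrable V (c := fun _ => 16 * M ^ 2) (fun s => by positivity) (integrableOn_const (by simp) enorm_ne_top)
  have hEm := (EE_cont hη hχ).measurable
  have hTm := Theta_meas V
  have : Integrable (fun q : ℝ × (V3 × V3) => (⟪EE η χ w q.2.1 - EE η χ w q.2.2, Theta γ F W q⟫ : ℝ)) ((volume.restrict (Set.Ioc 0 T)).prod volume) := by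
    refine hdom.mono' (Measurable.aestronglyMeasurable (Measurable.inner (by fun_prop) (by fun_prop))) (Filter.Eventually.of_forall fun q => ?_)
    exact lip_dom V hM q.1 q.2 le_rfl (b1 _ _) (b1 _ _) (b2 _ _ _)
  exact IntegrableOn.mono_set this.integral_prod_left hsub

end

section
variable {γ T : ℝ} {S : Setting γ T} {F : ℝ × V3 → ℝ} {W : ℝ × (V3 × V3) → V3}
variable {η χ : V3 → ℝ}
variable {E : Type*} [NormedAddCommGroup E] [NormedSpace ℝ E]

/-- mollification -/
def mol (η : V3 → ℝ) (h : V3 → E) (v : V3) : E := ∫ x, η x • h (v - x)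

/-- mollifier -/
structure IsMol (η : V3 → ℝ) : Prop where
  smooth : ContDiff ℝ 2 η
  hcs : HasCompactSupport η
  nonneg : ∀ x, 0 ≤ η x
  int : ∫ x, η x = 1
  supp : ∀ x, 1 < ‖x‖ → η x = 0

theorem IsMol.integrable (h : IsMol η) : Integrable η := h.smooth.continuous.integrable_of_hasCompactSupport h.hcs

theorem IsMol.norm_le (hη : IsMol η) {k : V3 → E} {B : ℝ} (hk : ∀ x, ‖x‖ ≤ 1 → ‖k x‖ ≤ B) :
    ‖∫ x, η x • k x‖ ≤ B := by
  refine (norm_integral_le_of_norm_le (hη.integrable.mul_const B) (Filter.Eventually.of_forall fun x => ?_)).trans ?_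
  · rw [norm_smul, Real.norm_eq_abs, abs_of_nonneg (hη.nonneg x)]
    by_cases hx : ‖x‖ ≤ 1
    · exact mul_le_mul_of_nonneg_left (hk x hx) (hη.nonneg x)
    · rw [hη.supp x (not_le.1 hx)]; simp
  · rw [integral_mul_const, hη.int, one_mul]

theorem cs_int (hη : ContDiff ℝ 2 η) (cη : HasCompactSupport η) {h : V3 → E} (hh : Continuous h) (v : V3) :
    Integrable (fun x => η x • h (v - x)) :=
  (hη.continuous.smul (hh.comp (by fun_prop))).integrable_of_hasCompactSupport cη.smul_right

theorem mol_sub_le (hη : IsMol η) {h : V3 → E} (hh : Continuous h) {v v' : V3} {B : ℝ}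
    (hB : ∀ x, ‖x‖ ≤ 1 → ‖h (v - x) - h (v' - x)‖ ≤ B) : ‖mol η h v - mol η h v'‖ ≤ B := by
  unfold mol
  rw [← integral_sub (cs_int hη.smooth hη.hcs hh v) (cs_int hη.smooth hη.hcs hh v')]
  simp only [← smul_sub]
  exact hη.norm_le hB

theorem Phi_eq (s : ℝ) (v : V3) : Phi S η χ s v = χ v * mol η (LL S s) v := by
  unfold Phi psi mol
  rw [← integral_sub_left_eq_self _ volume v, ← integral_const_mul]
  congr 1
  ext w
  simp only [sub_sub_cancel, smul_eq_mul]
  ring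

theorem dPhi_eq (s : ℝ) (v : V3) : dPhi S η χ s v = χ v * mol η (dLL S s) v := by
  unfold dPhi psi mol
  rw [← integral_sub_left_eq_self _ volume v, ← integral_const_mul]
  congr 1
  ext w
  simp only [sub_sub_cancel, smul_eq_mul]
  ring

theorem mol_ibp (hη : ContDiff ℝ 2 η) (cη : HasCompactSupport η) {s : ℝ} (hs : s ∈ Set.Icc 0 T) (v : V3) :
    ∫ x, LL S s (v - x) • gradient η x = mol η (logGrad (S.g s)) v := by
  have hL := (LL_vel S hs).continuous
  have hD := logGrad_cont S hs
  have hgc := gradient_continuous (hη.of_le (by norm_num : (1 : WithTop ℕ∞) ≤ 2))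
  have hLc : Continuous fun x => LL S s (v - x) := by fun_prop
  have hDc : Continuous fun x => logGrad (S.g s) (v - x) := by fun_prop
  have i1 : Integrable fun x => LL S s (v - x) • gradient η x :=
    (hLc.smul hgc).integrable_of_hasCompactSupport (grad_hcs cη).smul_left
  have i2 : Integrable (fun x => η x • logGrad (S.g s) (v - x)) := cs_int hη cη hD v
  have hfd : ∀ x, HasFDerivAt (fun x => LL S s (v - x)) (-(InnerProductSpace.toDual ℝ V3 (logGrad (S.g s) (v - x)))) x := by
    intro x
    have h1 := (LL_grad S hs (v - x)).hasFDerivAt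
    have h2 := HasFDerivAt.comp x h1 ((hasFDerivAt_id x).const_sub v)
    rw [ContinuousLinearMap.comp_neg, ContinuousLinearMap.comp_id] at h2
    exact h2
  have hge : ∀ x e, fderiv ℝ η x e = ⟪e, gradient η x⟫ := by
    intro x e
    rw [real_inner_comm]
    simp [gradient]
  refine ext_inner_left ℝ fun e => ?_
  unfold mol
  rw [← integral_inner i1, ← integral_inner i2]
  have key := integral_mul_fderiv_eq_neg_fderiv_mul_of_integrable (μ := (volume : Measure V3)) (f := fun x => LL S s (v - x)) (g := η) (v := e) ?_ ?_ ?_ ?_ ?_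
  · calc ∫ x, ⟪e, LL S s (v - x) • gradient η x⟫ = ∫ x, LL S s (v - x) * fderiv ℝ η x e := by
          congr 1; ext x; rw [hge, real_inner_smul_right]
      _ = _ := key
      _ = _ := by
          rw [← integral_neg]
          congr 1
          ext x
          rw [(hfd x).fderiv, real_inner_smul_right, real_inner_comm]
          simp [mul_comm]
  · simp only [(hfd _).fderiv]
    have := (i2.inner_const (𝕜 := ℝ) e).neg
    refine this.congr (Filter.Eventually.of_forall fun x => ?_)
    simp only [Pi.neg_apply, real_inner_smul_left, _root_.neg_apply, InnerProductSpace.toDual_apply_apply]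
    ring
  · have := (i1.const_inner (𝕜 := ℝ) e)
    refine this.congr (Filter.Eventually.of_forall fun x => ?_)
    simp only [real_inner_smul_right]
    rw [hge]
  · have := cs_int hη cη hL v
    refine this.congr (Filter.Eventually.of_forall fun x => ?_)
    simp [mul_comm]
  · exact fun x _ => (hfd x).differentiableAt
  · exact fun x _ => hη.differentiable (by norm_num) x

theorem Dn_eq (hη : ContDiff ℝ 2 η) (cη : HasCompactSupport η) {s : ℝ} (hs : s ∈ Set.Icc 0 T) (v : V3) :
    Dn S η χ s v = χ v • mol η (logGrad (S.g s)) v + mol η (LL S s) v • gradient χ v := by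
  have hL := (LL_vel S hs).continuous
  have hgc := gradient_continuous (hη.of_le (by norm_num : (1 : WithTop ℕ∞) ≤ 2))
  have hLc : Continuous fun x => LL S s (v - x) := by fun_prop
  have i1 : Integrable fun x => LL S s (v - x) • gradient η x :=
    (hLc.smul hgc).integrable_of_hasCompactSupport (grad_hcs cη).smul_left
  rw [← mol_ibp hη cη hs]
  unfold Dn EE
  rw [← integral_sub_left_eq_self _ volume v]
  simp only [sub_sub_cancel]
  have i2 := cs_int hη cη hL v
  rw [mol, ← integral_smul, ← integral_smul_const, ← integral_add (f := fun x => χ v • LL S s (v - x) • gradient η x) (i1.smul (χ v)) (i2.smul_const (gradient χ v))]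
  congr 1
  ext1 x
  simp only [smul_add, Pi.smul_apply, smul_smul, smul_eq_mul]
  congr 2 <;> ring

theorem jap_seg {x y z : V3} (hz : z ∈ segment ℝ x y) : jap z ≤ max (jap x) (jap y) := by
  have h := (convexOn_univ_norm (E := V3)).le_max_of_mem_segment (Set.mem_univ x) (Set.mem_univ y) hz
  rcases le_max_iff.1 h with h | h
  · refine le_max_of_le_left ?_
    unfold jap; gcongr
  · refine le_max_of_le_right ?_
    unfold jap; gcongr

theorem jap_sub_le (v : V3) {x : V3} (hx : ‖x‖ ≤ 1) : jap (v - x) ≤ 2 * jap v := by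
  have h := jap_le_add v (v - x)
  rw [sub_sub_cancel] at h
  have := jap_ge_one v
  linarith

theorem jap_sub_rpow {a : ℝ} (ha : 0 ≤ a) {v x : V3} {J : ℝ} (hJ : jap v ≤ J) (hx : ‖x‖ ≤ 1) : jap (v - x) ^ a ≤ 2 ^ a * J ^ a := by
  have h0 := jap_pos v
  rw [← Real.mul_rpow (by norm_num) (by linarith)]
  refine Real.rpow_le_rpow (jap_pos _).le ?_ ha
  have := jap_sub_le v hx
  linarith

theorem molL_bd (hη : IsMol η) {s : ℝ} (hs : s ∈ Set.Icc 0 T) (v : V3) :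
    |mol η (LL S s) v| ≤ (c0 S + S.K1 s) * (2 ^ (S.κ + 1) * jap v ^ (S.κ + 1)) := by
  rw [← Real.norm_eq_abs]
  exact hη.norm_le fun x hx => (LL_bd S hs (v - x)).trans 
    (mul_le_mul_of_nonneg_left (jap_sub_rpow (by linarith [S.hκ]) le_rfl hx) (add_nonneg (c0_nonneg S) (S.K1nonneg s)))

theorem moldL_bd (hη : IsMol η) {s : ℝ} (hs : s ∈ Set.Icc 0 T) (v : V3) :
    |mol η (dLL S s) v| ≤ S.K2 s * (2 ^ S.ν * jap v ^ S.ν) := by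
  rw [← Real.norm_eq_abs]
  exact hη.norm_le fun x hx => (dLL_bd S hs (v - x)).trans 
    (mul_le_mul_of_nonneg_left (jap_sub_rpow (by linarith [S.hν]) le_rfl hx) (S.K2nonneg s))

theorem molD_bd (hη : IsMol η) {s : ℝ} (hs : s ∈ Set.Icc 0 T) (v : V3) :
    ‖mol η (logGrad (S.g s)) v‖ ≤ S.K1 s * (2 ^ S.κ * jap v ^ S.κ) :=
  hη.norm_le fun x hx => (S.K1bound s hs (v - x)).trans 
    (mul_le_mul_of_nonneg_left (jap_sub_rpow (by linarith [S.hκ]) le_rfl hx) (S.K1nonneg s))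

theorem seg_bd {a : ℝ} (ha : 0 ≤ a) {v v' x : V3} (hx : ‖x‖ ≤ 1) : 
    ∀ z ∈ segment ℝ (v' - x) (v - x), jap z ^ a ≤ 2 ^ a * (max (jap v) (jap v')) ^ a := by
  intro z hz
  have h0 := jap_pos v
  rw [← Real.mul_rpow (by norm_num) (by positivity)]
  refine Real.rpow_le_rpow (jap_pos _).le ((jap_seg hz).trans (max_le ?_ ?_)) ha
  · have := jap_sub_le v' hx
    have := le_max_right (jap v) (jap v')
    linarith
  · have := jap_sub_le v hx
    have := le_max_left (jap v) (jap v')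
    linarith

theorem molL_lip (hη : IsMol η) {s : ℝ} (hs : s ∈ Set.Icc 0 T) (v v' : V3) :
    |mol η (LL S s) v - mol η (LL S s) v'| ≤ S.K1 s * (2 ^ S.κ * (max (jap v) (jap v')) ^ S.κ) * ‖v - v'‖ := by
  refine mol_sub_le hη (LL_vel S hs).continuous fun x hx => ?_
  have := LL_lip S hs (v' - x) (v - x) _ (seg_bd (by linarith [S.hκ]) hx)
  rwa [sub_sub_sub_cancel_right] at this

theorem molD_lip (hη : IsMol η) {s : ℝ} (hs : s ∈ Set.Icc 0 T) (v v' : V3) :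
    ‖mol η (logGrad (S.g s)) v - mol η (logGrad (S.g s)) v'‖ ≤ 9 * (S.K3 s * (2 ^ S.ζ * (max (jap v) (jap v')) ^ S.ζ)) * ‖v - v'‖ := by
  refine mol_sub_le hη (logGrad_cont S hs) fun x hx => ?_
  have := DD_lip S hs (v' - x) (v - x) _ (seg_bd S.hζ hx)
  rwa [sub_sub_sub_cancel_right] at this

end

section
variable {γ T : ℝ} {S : Setting γ T} {F : ℝ × V3 → ℝ} {W : ℝ × (V3 × V3) → V3}
variable {η χ : V3 → ℝ}

/-- cutoff -/
structure IsCut (A : ℝ) (χ : V3 → ℝ) : Prop where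
  smooth : ContDiff ℝ 2 χ
  hcs : HasCompactSupport χ
  le_one : ∀ v, |χ v| ≤ 1
  lip : ∀ v v', |χ v - χ v'| ≤ A * ‖v - v'‖
  gbd : ∀ v, jap v * ‖gradient χ v‖ ≤ A
  glip : ∀ v v', ‖v - v'‖ ≤ 1 → jap v * ‖gradient χ v - gradient χ v'‖ ≤ A * ‖v - v'‖

/-- weight -/
def cS (S : Setting γ T) (s : ℝ) : ℝ := c0 S + S.K1 s + 9 * S.K3 s

theorem Dn_size {A : ℝ} (hA : 0 ≤ A) (hη : IsMol η) (hχ : IsCut A χ) {s : ℝ} (hs : s ∈ Set.Icc 0 T) (v : V3) :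
    ‖Dn S η χ s v‖ ≤ (1 + A) * 2 ^ (S.κ + S.ζ + 1) * cS S s * jap v ^ S.κ := by
  rw [Dn_eq hη.smooth hη.hcs hs]
  have h1 := molD_bd (S := S) hη hs v
  have h2 := molL_bd (S := S) hη hs v
  have hz := S.hζ
  have hk := S.hκ
  have p1 : (2:ℝ) ^ S.κ ≤ 2 ^ (S.κ + S.ζ + 1) := Real.rpow_le_rpow_of_exponent_le (by norm_num) (by linarith)
  have p2 : (2:ℝ) ^ (S.κ + 1) ≤ 2 ^ (S.κ + S.ζ + 1) := Real.rpow_le_rpow_of_exponent_le (by norm_num) (by linarith)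
  set P : ℝ := 2 ^ (S.κ + S.ζ + 1)
  have hP : 0 < P := by positivity
  have hj := jap_rpow_pos S.κ v
  have hj0 := jap_pos v
  have hc := c0_nonneg S
  have hK1 := S.K1nonneg s
  have hK3 := S.K3nonneg s
  have e1 : ‖χ v • mol η (logGrad (S.g s)) v‖ ≤ cS S s * P * jap v ^ S.κ := by
    rw [norm_smul, Real.norm_eq_abs]
    calc |χ v| * ‖mol η (logGrad (S.g s)) v‖ ≤ 1 * (S.K1 s * (P * jap v ^ S.κ)) := 
          mul_le_mul (hχ.le_one v) (h1.trans (by gcongr)) (norm_nonneg _) zero_le_one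
      _ ≤ cS S s * (P * jap v ^ S.κ) := by
          rw [one_mul]
          refine mul_le_mul_of_nonneg_right ?_ (by positivity)
          unfold cS; linarith
      _ = _ := by ring
  have e2 : ‖mol η (LL S s) v • gradient χ v‖ ≤ A * (cS S s * P * jap v ^ S.κ) := by
    rw [norm_smul, Real.norm_eq_abs]
    have h5 : jap v ^ (S.κ + 1) = jap v ^ S.κ * jap v := by
      rw [Real.rpow_add (jap_pos v), Real.rpow_one]
    calc |mol η (LL S s) v| * ‖gradient χ v‖ ≤ ((c0 S + S.K1 s) * (P * jap v ^ (S.κ + 1))) * ‖gradient χ v‖ := by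
          refine mul_le_mul_of_nonneg_right (h2.trans ?_) (norm_nonneg _)
          have := jap_rpow_pos (S.κ + 1) v
          gcongr
      _ = ((c0 S + S.K1 s) * (P * jap v ^ S.κ)) * (jap v * ‖gradient χ v‖) := by rw [h5]; ring
      _ ≤ (cS S s * (P * jap v ^ S.κ)) * A := by
          refine mul_le_mul (mul_le_mul_of_nonneg_right ?_ (by positivity)) (hχ.gbd v) (by positivity) ?_
          · unfold cS; linarith
          · unfold cS; positivity
      _ = _ := by ring
  refine (norm_add_le_of_le e1 e2).trans (le_of_eq (by ring))

theorem Dn_diff {A : ℝ} (hA : 0 ≤ A) (hη : IsMol η) (hχ : IsCut A χ) {s : ℝ} (hs : s ∈ Set.Icc 0 T) (v v' : V3)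
    (hvv : ‖v - v'‖ ≤ 1) :
    ‖Dn S η χ s v - Dn S η χ s v'‖ ≤ (1 + 3 * A) * 2 ^ (S.κ + S.ζ + 1) * cS S s * ‖v - v'‖ * (max (jap v) (jap v')) ^ (max S.κ S.ζ) := by
  rw [Dn_eq hη.smooth hη.hcs hs, Dn_eq hη.smooth hη.hcs hs]
  set a := mol η (logGrad (S.g s)) with ha
  set b := mol η (LL S s) with hb
  have h1 : ‖a v'‖ ≤ _ := molD_bd (S := S) hη hs v'
  have h2 : |b v| ≤ _ := molL_bd (S := S) hη hs v
  have h3 : ‖a v - a v'‖ ≤ _ := molD_lip (S := S) hη hs v v'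
  have h4 : |b v - b v'| ≤ _ := molL_lip (S := S) hη hs v v'
  have hz := S.hζ
  have hk := S.hκ
  have p1 : (2:ℝ) ^ S.κ ≤ 2 ^ (S.κ + S.ζ + 1) := Real.rpow_le_rpow_of_exponent_le (by norm_num) (by linarith)
  have p2 : (2:ℝ) ^ (S.κ + 1) ≤ 2 ^ (S.κ + S.ζ + 1) := Real.rpow_le_rpow_of_exponent_le (by norm_num) (by linarith)
  have p3 : (2:ℝ) ^ S.ζ ≤ 2 ^ (S.κ + S.ζ + 1) := Real.rpow_le_rpow_of_exponent_le (by norm_num) (by linarith)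
  set P : ℝ := 2 ^ (S.κ + S.ζ + 1)
  have hP : 0 < P := by positivity
  set J := max (jap v) (jap v') with hJ
  have hJv : jap v ≤ J := le_max_left _ _
  have hJv' : jap v' ≤ J := le_max_right _ _
  have hv1 := jap_ge_one v
  have hv1' := jap_ge_one v'
  have hJ1 : 1 ≤ J := hv1.trans hJv
  have hc := c0_nonneg S
  have hK1 := S.K1nonneg s
  have hK3 := S.K3nonneg s
  set Q := J ^ (max S.κ S.ζ) with hQ
  have hQ0 : 0 < Q := by positivity
  have q1 : J ^ S.κ ≤ Q := Real.rpow_le_rpow_of_exponent_le hJ1 (le_max_left _ _)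
  have q2 : J ^ S.ζ ≤ Q := Real.rpow_le_rpow_of_exponent_le hJ1 (le_max_right _ _)
  have q3 : jap v' ^ S.κ ≤ Q := (Real.rpow_le_rpow (by linarith) hJv' (by linarith)).trans q1
  have q4 : jap v ^ S.κ ≤ Q := (Real.rpow_le_rpow (by linarith) hJv (by linarith)).trans q1
  set z := ‖v - v'‖ with hzz
  have hz0 : 0 ≤ z := norm_nonneg _
  have hcS0 : 0 ≤ cS S s := by unfold cS; positivity
  have c1 : S.K1 s ≤ cS S s := by unfold cS; linarith
  have c2 : 9 * S.K3 s ≤ cS S s := by unfold cS; linarith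
  have c3 : c0 S + S.K1 s ≤ cS S s := by unfold cS; linarith
  have t1 : ‖χ v • (a v - a v')‖ ≤ P * cS S s * z * Q := by
    rw [norm_smul, Real.norm_eq_abs]
    calc |χ v| * ‖a v - a v'‖ ≤ 1 * (9 * (S.K3 s * (P * Q)) * z) := 
          mul_le_mul (hχ.le_one v) (h3.trans (by gcongr)) (norm_nonneg _) zero_le_one
      _ = (9 * S.K3 s) * (P * Q * z) := by ring
      _ ≤ cS S s * (P * Q * z) := by gcongr
      _ = _ := by ring
  have t2 : ‖(χ v - χ v') • a v'‖ ≤ A * (P * cS S s * z * Q) := by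
    rw [norm_smul, Real.norm_eq_abs]
    calc |χ v - χ v'| * ‖a v'‖ ≤ (A * z) * (cS S s * (P * Q)) := 
          mul_le_mul (hχ.lip v v') (h1.trans (by gcongr)) (norm_nonneg _) (by positivity)
      _ = _ := by ring
  have t3 : ‖b v • (gradient χ v - gradient χ v')‖ ≤ A * (P * cS S s * z * Q) := by
    rw [norm_smul, Real.norm_eq_abs]
    have h5 : jap v ^ (S.κ + 1) = jap v ^ S.κ * jap v := by
      rw [Real.rpow_add (jap_pos v), Real.rpow_one]
    calc |b v| * ‖gradient χ v - gradient χ v'‖ ≤ (cS S s * (P * (Q * jap v))) * ‖gradient χ v - gradient χ v'‖ := by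
          refine mul_le_mul_of_nonneg_right (h2.trans ?_) (norm_nonneg _)
          rw [h5]
          have := jap_pos v
          gcongr
      _ = (cS S s * (P * Q)) * (jap v * ‖gradient χ v - gradient χ v'‖) := by ring
      _ ≤ (cS S s * (P * Q)) * (A * z) := by
          refine mul_le_mul_of_nonneg_left (hχ.glip v v' hvv) (by positivity)
      _ = _ := by ring
  have t4 : ‖(b v - b v') • gradient χ v'‖ ≤ A * (P * cS S s * z * Q) := by
    rw [norm_smul, Real.norm_eq_abs]
    have hg : ‖gradient χ v'‖ ≤ A := by
      have := hχ.gbd v'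
      nlinarith [norm_nonneg (gradient χ v')]
    calc |b v - b v'| * ‖gradient χ v'‖ ≤ (cS S s * (P * Q) * z) * A := 
          mul_le_mul (h4.trans (by gcongr)) hg (norm_nonneg _) (by positivity)
      _ = _ := by ring
  have e : χ v • a v + b v • gradient χ v - (χ v' • a v' + b v' • gradient χ v') = 
      (χ v • (a v - a v') + (χ v - χ v') • a v') + (b v • (gradient χ v - gradient χ v') + (b v - b v') • gradient χ v') := by
    simp only [smul_sub, sub_smul]
    abel
  rw [e]
  refine (norm_add_le_of_le (norm_add_le_of_le t1 t2) (norm_add_le_of_le t3 t4)).trans (le_of_eq (by ring))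

theorem Dn_dom {A : ℝ} (hA : 0 ≤ A) (V : Ver S F W) (hη : IsMol η) (hχ : IsCut A χ) {s : ℝ} (hs : s ∈ Set.Icc 0 T) (p : V3 × V3) :
    ‖(⟪Dn S η χ s p.1 - Dn S η χ s p.2, Theta γ F W (s, p)⟫ : ℝ)‖ ≤ 
      Dom S F W (fun s => 4 * ((2 + 3 * A) * 2 ^ (S.κ + S.ζ + 1) * cS S s) ^ 2) (s, p) := by
  have hcS0 : 0 ≤ cS S s := by
    have hc := c0_nonneg S
    have hK1 := S.K1nonneg s
    have hK3 := S.K3nonneg s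
    unfold cS; positivity
  have hP : (0:ℝ) < 2 ^ (S.κ + S.ζ + 1) := by positivity
  have hk : 0 ≤ S.κ := by linarith [S.hκ]
  have hM := (jap_pos p.1).trans_le (le_max_left (jap p.1) (jap p.2))
  refine inner_Theta_le V (s, p) _ ((2 + 3 * A) * 2 ^ (S.κ + S.ζ + 1) * cS S s) (by positivity) le_rfl ?_ ?_
  · have h1 := Dn_size (S := S) hA hη hχ hs p.1
    have h2 := Dn_size (S := S) hA hη hχ hs p.2
    have j1 : jap p.1 ^ S.κ ≤ max (jap p.1) (jap p.2) ^ S.κ := Real.rpow_le_rpow (jap_pos _).le (le_max_left _ _) hk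
    have j2 : jap p.2 ^ S.κ ≤ max (jap p.1) (jap p.2) ^ S.κ := Real.rpow_le_rpow (jap_pos _).le (le_max_right _ _) hk
    have hB : 0 ≤ (1 + A) * 2 ^ (S.κ + S.ζ + 1) * cS S s := by positivity
    have h3 := mul_le_mul_of_nonneg_left j1 hB
    have h4 := mul_le_mul_of_nonneg_left j2 hB
    have h5 := norm_sub_le (Dn S η χ s p.1) (Dn S η χ s p.2)
    have h6 : 0 ≤ A * 2 ^ (S.κ + S.ζ + 1) * cS S s * max (jap p.1) (jap p.2) ^ S.κ := by positivity
    simp only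
    linarith
  · intro hp
    refine (Dn_diff hA hη hχ hs p.1 p.2 hp).trans ?_
    simp only
    gcongr
    linarith

theorem cS_int (S : Setting γ T) (a b : ℝ) : IntegrableOn (fun s => a * (b * cS S s) ^ 2) (Set.Ioc 0 T) := by
  obtain ⟨-, h1, h3⟩ := Kint_facts S
  have hm := S.K1meas
  have hm3 := S.K3meas
  have hb : IntegrableOn (fun s => b ^ 2 * (3 * c0 S ^ 2 + 3 * S.K1 s ^ 2 + 243 * S.K3 s ^ 2)) (Set.Ioc 0 T) :=
    Integrable.const_mul (((integrableOn_const (by simp) enorm_ne_top).add (h1.const_mul 3)).add (h3.const_mul 243)) _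
  refine Integrable.const_mul ?_ a
  refine Integrable.mono' hb (Measurable.aestronglyMeasurable (by unfold cS; fun_prop)) (Filter.Eventually.of_forall fun s => ?_)
  rw [Real.norm_eq_abs, abs_of_nonneg (sq_nonneg _), mul_pow]
  refine mul_le_mul_of_nonneg_left ?_ (sq_nonneg b)
  unfold cS
  nlinarith [sq_nonneg (c0 S - S.K1 s), sq_nonneg (c0 S - 9 * S.K3 s), sq_nonneg (S.K1 s - 9 * S.K3 s)]

end

section

open scoped Topology in
theorem exists_mol : ∃ η : ℕ → V3 → ℝ, (∀ n, IsMol (η n)) ∧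
    (∀ h : V3 → ℝ, Continuous h → ∀ v, Filter.Tendsto (fun n => mol (η n) h v) Filter.atTop (𝓝 (h v))) ∧
    (∀ h : V3 → V3, Continuous h → ∀ v, Filter.Tendsto (fun n => mol (η n) h v) Filter.atTop (𝓝 (h v))) ∧
    (∀ h : V3 → ℝ, LocallyIntegrable h → ∀ᵐ v, Filter.Tendsto (fun n => mol (η n) h v) Filter.atTop (𝓝 (h v))) := by
  let φ : ℕ → ContDiffBump (0 : V3) := fun n => ⟨1 / ((n:ℝ) + 2), 2 / ((n:ℝ) + 2), by positivity, by
    gcongr; norm_num⟩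
  have hr : ∀ n, (φ n).rOut = 2 / ((n:ℝ) + 2) := fun n => rfl
  have ht : Filter.Tendsto (fun n => (φ n).rOut) Filter.atTop (𝓝 0) := by
    simp only [hr]
    refine Filter.Tendsto.div_atTop tendsto_const_nhds ?_
    exact Filter.tendsto_atTop_add_const_right _ _ tendsto_natCast_atTop_atTop
  refine ⟨fun n => (φ n).normed volume, fun n => ⟨?_, ?_, ?_, ?_, ?_⟩, ?_, ?_, ?_⟩
  · exact (φ n).contDiff_normed (n := 2)
  · exact (φ n).hasCompactSupport_normed
  · exact fun x => (φ n).nonneg_normed x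
  · exact (φ n).integral_normed
  · intro x hx
    have : x ∉ Function.support ((φ n).normed volume) := by
      rw [(φ n).support_normed_eq, mem_ball_zero_iff, hr, not_lt]
      refine le_trans ?_ hx.le
      rw [div_le_one (by positivity)]
      have : (0:ℝ) ≤ n := by positivity
      linarith
    simpa using this
  · intro h hh v
    exact ContDiffBump.convolution_tendsto_right_of_continuous (φ := φ) (μ := volume) ht hh v
  · intro h hh v
    exact ContDiffBump.convolution_tendsto_right_of_continuous (φ := φ) (μ := volume) ht hh v
  · intro h hh
    refine ContDiffBump.ae_convolution_tendsto_right_of_locallyIntegrable (φ := φ) (μ := volume) (K := 2) ht ?_ hh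
    refine Filter.Eventually.of_forall fun n => ?_
    change 2 / ((n:ℝ) + 2) ≤ 2 * (1 / ((n:ℝ) + 2))
    apply le_of_eq; ring

theorem grad_scale {χ : V3 → ℝ} (h : ContDiff ℝ 2 χ) (c : ℝ) (v : V3) :
    gradient (fun w => χ (c • w)) v = c • gradient χ (c • v) := by
  have hd : HasFDerivAt χ (fderiv ℝ χ (c • v)) (c • v) := (h.differentiable (by norm_num) _).hasFDerivAt
  have hl : HasFDerivAt (fun w : V3 => c • w) (c • ContinuousLinearMap.id ℝ V3) v :=
    (hasFDerivAt_id v).const_smul c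
  have := hd.comp v hl
  unfold gradient
  rw [show (fun w => χ (c • w)) = χ ∘ (fun w => c • w) from rfl, this.fderiv, ← map_smul]
  congr 1
  ext x
  simp

open scoped Topology in
theorem exists_cut : ∃ (A : ℝ) (χ : ℕ → V3 → ℝ), 0 ≤ A ∧ (∀ n, IsCut A (χ n)) ∧
    (∀ v, Filter.Tendsto (fun n => χ n v) Filter.atTop (𝓝 1)) ∧
    (∀ v, Filter.Tendsto (fun n => gradient (χ n) v) Filter.atTop (𝓝 0)) := by
  let b : ContDiffBump (0 : V3) := ⟨1, 2, by norm_num, by norm_num⟩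
  let X : V3 → ℝ := b
  have hX : ContDiff ℝ 2 X := b.contDiff
  have cX : HasCompactSupport X := b.hasCompactSupport
  obtain ⟨M1, m1, b1, l1⟩ := cc_bd (hX.of_le (by norm_num)) cX
  obtain ⟨M2, m2, b2, l2⟩ := cc_bd (gradient_contDiff (n := 1) (h := X) (by convert hX using 1; norm_num)) (grad_hcs cX)
  obtain ⟨R, hR, hz⟩ := hcs_ball cX
  have hc : ∀ n : ℕ, 0 < 1 / ((n:ℝ) + 1) := fun n => by positivity
  have hc1 : ∀ n : ℕ, 1 / ((n:ℝ) + 1) ≤ 1 := fun n => by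
    rw [div_le_one (by positivity)]; linarith [(Nat.cast_nonneg n : (0:ℝ) ≤ n)]
  have key : ∀ (n : ℕ) v, 1 / ((n:ℝ) + 1) * ‖v‖ ≤ R + 1 / ((n:ℝ) + 1) → jap v * (1 / ((n:ℝ) + 1)) ≤ R + 2 := by
    intro n v h
    have h1 := mul_le_mul_of_nonneg_right (jap_le_one_add v) (hc n).le
    have := hc1 n
    nlinarith
  have hcn : ∀ v : V3, Filter.Tendsto (fun n : ℕ => (1 / ((n:ℝ) + 1)) • v) Filter.atTop (𝓝 0) := by
    intro v
    have := (tendsto_one_div_add_atTop_nhds_zero_nat (𝕜 := ℝ)).smul_const v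
    simpa using this
  have h0 : X =ᶠ[𝓝 0] 1 := b.eventuallyEq_one
  have hX0 : X 0 = 1 := h0.eq_of_nhds
  have hG0 : gradient X 0 = 0 := by
    unfold gradient
    rw [h0.fderiv_eq]
    simp
  refine ⟨(R + 2) * (M1 + M2), fun n v => X ((1 / ((n:ℝ) + 1)) • v), by positivity, fun n => ?_, fun v => ?_, fun v => ?_⟩
  · have hA : M1 ≤ (R + 2) * (M1 + M2) := by nlinarith
    have hA2 : (R + 2) * M2 ≤ (R + 2) * (M1 + M2) := by gcongr; linarith
    have hns : ∀ v v' : V3, ‖(1 / ((n:ℝ) + 1)) • v - (1 / ((n:ℝ) + 1)) • v'‖ = 1 / ((n:ℝ) + 1) * ‖v - v'‖ := by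
      intro v v'
      rw [← smul_sub, norm_smul, Real.norm_eq_abs, abs_of_pos (hc n)]
    have hnn : ∀ v : V3, ‖(1 / ((n:ℝ) + 1)) • v‖ = 1 / ((n:ℝ) + 1) * ‖v‖ := by
      intro v
      rw [norm_smul, Real.norm_eq_abs, abs_of_pos (hc n)]
    refine ⟨hX.comp (contDiff_const_smul _), cX.comp_smul (hc n).ne', fun v => ?_, fun v v' => ?_, fun v => ?_, fun v v' hv => ?_⟩
    · rw [abs_of_nonneg b.nonneg]
      exact b.le_one
    · refine (l1 _ _).trans ?_
      rw [hns]
      have h3 := norm_nonneg (v - v')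
      calc M1 * (1 / ((n:ℝ) + 1) * ‖v - v'‖) ≤ M1 * (1 * ‖v - v'‖) := by gcongr; exact hc1 n
        _ ≤ _ := by rw [one_mul]; gcongr
    · rw [grad_scale hX, norm_smul, Real.norm_eq_abs, abs_of_pos (hc n)]
      by_cases h : 1 / ((n:ℝ) + 1) * ‖v‖ ≤ R
      · have h1 := key n v (h.trans (by linarith [hc n]))
        rw [← mul_assoc]
        refine le_trans ?_ hA2
        gcongr
        exact b2 _
      · rw [(hz _ (by rw [hnn]; exact not_le.1 h)).2]
        simp; positivity
    · rw [grad_scale hX, grad_scale hX, ← smul_sub, norm_smul, Real.norm_eq_abs, abs_of_pos (hc n)]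
      by_cases h : 1 / ((n:ℝ) + 1) * ‖v‖ ≤ R + 1 / ((n:ℝ) + 1)
      · have h1 := key n v h
        rw [← mul_assoc]
        have h3 := norm_nonneg (v - v')
        have h4 : ‖gradient X ((1 / ((n:ℝ) + 1)) • v) - gradient X ((1 / ((n:ℝ) + 1)) • v')‖ ≤ M2 * ‖v - v'‖ := by
          refine (l2 _ _).trans ?_
          rw [hns]
          gcongr
          have := mul_le_mul_of_nonneg_right (hc1 n) h3
          linarith
        calc jap v * (1 / ((n:ℝ) + 1)) * _ ≤ (R + 2) * (M2 * ‖v - v'‖) := by gcongr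
          _ ≤ _ := by rw [← mul_assoc]; gcongr
      · push Not at h
        have h5 : ‖v‖ ≤ ‖v'‖ + 1 := by
          have := norm_sub_norm_le v v'
          linarith
        have h6 := mul_le_mul_of_nonneg_left h5 (hc n).le
        have h7 := hc n
        rw [(hz _ (by rw [hnn]; linarith)).2, (hz ((1 / ((n:ℝ) + 1)) • v') (by rw [hnn]; linarith)).2]
        simp; positivity
  · have := (hX.continuous.tendsto 0).comp (hcn v)
    rw [hX0] at this
    exact this
  · simp only [grad_scale hX]
    have h1 := ((gradient_continuous (h := X) (hX.of_le (by norm_num))).tendsto 0).comp (hcn v)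
    have h2 := (tendsto_one_div_add_atTop_nhds_zero_nat (𝕜 := ℝ)).smul h1
    simpa using h2

end

section
variable {γ T : ℝ} {S : Setting γ T} {F : ℝ × V3 → ℝ} {W : ℝ × (V3 × V3) → V3}

/-- approximating data -/
structure Appr (A : ℝ) (η χ : ℕ → V3 → ℝ) : Prop where
  hA : 0 ≤ A
  mol : ∀ n, IsMol (η n)
  cut : ∀ n, IsCut A (χ n)
  lim1 : ∀ h : V3 → ℝ, Continuous h → ∀ v, Filter.Tendsto (fun n => _root_.mol (η n) h v) Filter.atTop (nhds (h v))
  lim3 : ∀ h : V3 → V3, Continuous h → ∀ v, Filter.Tendsto (fun n => _root_.mol (η n) h v) Filter.atTop (nhds (h v))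
  limae : ∀ h : V3 → ℝ, LocallyIntegrable h → ∀ᵐ v, Filter.Tendsto (fun n => _root_.mol (η n) h v) Filter.atTop (nhds (h v))
  limc : ∀ v, Filter.Tendsto (fun n => χ n v) Filter.atTop (nhds 1)
  limg : ∀ v, Filter.Tendsto (fun n => gradient (χ n) v) Filter.atTop (nhds 0)

theorem exists_appr : ∃ A η χ, Appr A η χ := by
  obtain ⟨η, h1, h2, h3, h4⟩ := exists_mol
  obtain ⟨A, χ, k1, k2, k3, k4⟩ := exists_cut
  exact ⟨A, η, χ, k1, h1, k2, h2, h3, h4, k3, k4⟩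

variable {A : ℝ} {η χ : ℕ → V3 → ℝ}

theorem mol_meas {e : V3 → ℝ} (he : Continuous e) {h : ℝ → V3 → ℝ} (hm : Measurable (fun q : ℝ × V3 => h q.1 q.2)) :
    StronglyMeasurable (fun q : ℝ × V3 => mol e (h q.1) q.2) := by
  unfold mol
  refine StronglyMeasurable.integral_prod_right' (f := fun z : (ℝ × V3) × V3 => e z.2 • h z.1.1 (z.1.2 - z.2)) ?_
  have h1 : Measurable fun z : (ℝ × V3) × V3 => h z.1.1 (z.1.2 - z.2) := 
    hm.comp (g := fun q : ℝ × V3 => h q.1 q.2) (f := fun z : (ℝ × V3) × V3 => (z.1.1, z.1.2 - z.2)) (by fun_prop)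
  have h2 : Measurable fun z : (ℝ × V3) × V3 => e z.2 := he.measurable.comp measurable_snd
  exact (h2.smul h1).stronglyMeasurable

theorem lim_one (V : Ver S F W) (P : Appr A η χ) {t : ℝ} (ht : t ∈ Set.Icc 0 T) :
    Filter.Tendsto (fun n => ∫ v, Phi S (η n) (χ n) t v * F (t, v)) Filter.atTop (nhds (∫ v, LL S t v * F (t, v))) := by
  have hc := c0_nonneg S
  have hK := S.K1nonneg t
  have hcon := (LL_vel S ht).continuous
  refine tendsto_integral_of_dominated_convergence (fun v => (c0 S + S.K1 t) * 2 ^ (S.κ + 1) * (jap v ^ mExp S * F (t, v))) ?_ ?_ ?_ ?_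
  · intro n
    have h1 := (mol_meas (P.mol n).smooth.continuous (h := fun _ => LL S t) (hcon.measurable.comp measurable_snd)).measurable
    have h2 : Measurable fun v => mol (η n) (LL S t) v := h1.comp (f := fun v => ((0:ℝ), v)) (by fun_prop)
    have h3 := (P.cut n).smooth.continuous.measurable
    have h4 : Measurable fun v => F (t, v) := V.Fm.comp (by fun_prop)
    simp only [Phi_eq]
    exact ((h3.mul h2).mul h4).aestronglyMeasurable
  · exact (F_mom V ht).1.const_mul _
  · intro n
    refine Filter.Eventually.of_forall fun v => ?_
    have h1 := molL_bd (S := S) (P.mol n) ht v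
    have h2 := (P.cut n).le_one v
    have h3 := V.F0 (t, v)
    have h4 := jap_rpow_mono (exp_facts S).2.2.2.2.1 v
    rw [Phi_eq, norm_mul, norm_mul, Real.norm_eq_abs, Real.norm_eq_abs, Real.norm_eq_abs, abs_of_nonneg h3]
    rw [← mul_assoc]
    refine mul_le_mul_of_nonneg_right ?_ h3
    calc |χ n v| * |mol (η n) (LL S t) v| ≤ 1 * ((c0 S + S.K1 t) * (2 ^ (S.κ + 1) * jap v ^ (mExp S))) := by
          refine mul_le_mul h2 (h1.trans ?_) (abs_nonneg _) zero_le_one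
          gcongr
      _ = _ := by ring
  · refine Filter.Eventually.of_forall fun v => ?_
    simp only [Phi_eq]
    have := ((P.limc v).mul (P.lim1 _ hcon v)).mul_const (F (t, v))
    simpa using this

/-- measurable extension of the time derivative -/
def Dx (S : Setting γ T) (s : ℝ) (w : V3) : ℝ := (Set.Ioo 0 T).indicator (fun s => dLL S s w) s

theorem Dx_eq {s : ℝ} (hs : s ∈ Set.Ioo 0 T) : Dx S s = dLL S s := by
  ext w; unfold Dx; rw [Set.indicator_of_mem hs]

theorem inn_bd (P : Appr A η χ) {s : ℝ} (hs : s ∈ Set.Icc 0 T) (n : ℕ) (v : V3) :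
    |χ n v * mol (η n) (dLL S s) v| ≤ (S.K2 s * 2 ^ S.ν) * jap v ^ S.ν := by
  have h1 := moldL_bd (S := S) (P.mol n) hs v
  have h2 := (P.cut n).le_one v
  rw [abs_mul]
  calc _ ≤ 1 * (S.K2 s * (2 ^ S.ν * jap v ^ S.ν)) := mul_le_mul h2 h1 (abs_nonneg _) zero_le_one
    _ = _ := by ring

theorem dLL_m {s : ℝ} (hs : s ∈ Set.Ioo 0 T) : Measurable (dLL S s) := by
  rw [← Dx_eq hs]
  exact (dLL_meas S).comp (f := fun w => (s, w)) (by fun_prop)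

theorem dLL_li {s : ℝ} (hs : s ∈ Set.Ioo 0 T) : LocallyIntegrable (dLL S s) := by
  have h1 : Continuous fun w => S.K2 s * jap w ^ S.ν := continuous_const.mul (jap_rpow_cont _)
  refine (h1.locallyIntegrable).mono (dLL_m hs).aestronglyMeasurable (Filter.Eventually.of_forall fun w => ?_)
  rw [Real.norm_eq_abs]
  exact (dLL_bd S (Set.Ioo_subset_Icc_self hs) w).trans (le_abs_self _)

theorem inn_lim (V : Ver S F W) (P : Appr A η χ) {s : ℝ} (hs : s ∈ Set.Ioo 0 T) :
    Filter.Tendsto (fun n => ∫ v, dPhi S (η n) (χ n) s v * F (s, v)) Filter.atTop (nhds (∫ v, dLL S s v * F (s, v))) := by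
  have hs' := Set.Ioo_subset_Icc_self hs
  have hK := S.K2nonneg s
  refine tendsto_integral_of_dominated_convergence (fun v => (S.K2 s * 2 ^ S.ν) * (jap v ^ mExp S * F (s, v))) ?_ ?_ ?_ ?_
  · intro n
    have h1 := (mol_meas (P.mol n).smooth.continuous (h := fun _ => dLL S s) ((dLL_m hs).comp measurable_snd)).measurable
    have h2 : Measurable fun v => mol (η n) (dLL S s) v := h1.comp (f := fun v => ((0:ℝ), v)) (by fun_prop)
    have h3 := (P.cut n).smooth.continuous.measurable
    have h4 : Measurable fun v => F (s, v) := V.Fm.comp (by fun_prop)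
    simp only [dPhi_eq]
    exact ((h3.mul h2).mul h4).aestronglyMeasurable
  · exact (F_mom V hs').1.const_mul _
  · intro n
    refine Filter.Eventually.of_forall fun v => ?_
    have h1 := inn_bd (S := S) P hs' n v
    have h3 := V.F0 (s, v)
    have h4 := jap_rpow_mono (exp_facts S).2.2.2.1 v
    rw [dPhi_eq, norm_mul, Real.norm_eq_abs, Real.norm_eq_abs, abs_of_nonneg h3, ← mul_assoc]
    refine mul_le_mul_of_nonneg_right (h1.trans ?_) h3
    gcongr
  · filter_upwards [P.limae _ (dLL_li hs)] with v hv
    simp only [dPhi_eq]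
    have := ((P.limc v).mul hv).mul_const (F (s, v))
    simpa using this

theorem ae_Ioo {t : ℝ} (ht : t ∈ Set.Icc 0 T) : ∀ᵐ s ∂(volume.restrict (Set.Ioc 0 t)), s ∈ Set.Ioo 0 T := by
  rw [ae_restrict_iff' measurableSet_Ioc]
  have : ∀ᵐ s : ℝ, s ≠ T := by simp [ae_iff]
  filter_upwards [this] with s h1 h2
  exact ⟨h2.1, lt_of_le_of_ne (h2.2.trans ht.2) h1⟩

theorem K2_int {t : ℝ} (ht : t ∈ Set.Icc 0 T) (a b : ℝ) : IntervalIntegrable (fun s => S.K2 s * a * b) volume 0 t := by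
  rw [intervalIntegrable_iff_integrableOn_Ioc_of_le ht.1]
  exact (((Kint_facts S).1.mono_set (Set.Ioc_subset_Ioc_right ht.2)).mul_const a).mul_const b

theorem lim_two (V : Ver S F W) (P : Appr A η χ) {t : ℝ} (ht : t ∈ Set.Icc 0 T) :
    Filter.Tendsto (fun n => ∫ s in (0:ℝ)..t, ∫ v, dPhi S (η n) (χ n) s v * F (s, v)) Filter.atTop 
      (nhds (∫ s in (0:ℝ)..t, ∫ v, dLL S s v * F (s, v))) := by
  have hio := ae_Ioo ht
  refine intervalIntegral.tendsto_integral_filter_of_dominated_convergence (fun s => S.K2 s * 2 ^ S.ν * S.Mf) ?_ ?_ (K2_int ht _ _) ?_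
  · refine Filter.Eventually.of_forall fun n => ?_
    rw [Set.uIoc_of_le ht.1]
    have h1 := (mol_meas (P.mol n).smooth.continuous (h := Dx S) (dLL_meas S)).measurable
    have h2 : Measurable fun q : ℝ × V3 => χ n q.2 := (P.cut n).smooth.continuous.measurable.comp measurable_snd
    have h3 := ((h2.mul h1).mul V.Fm).stronglyMeasurable.integral_prod_right' (ν := (volume : Measure V3))
    refine h3.aestronglyMeasurable.congr ?_
    filter_upwards [hio] with s hs
    simp only [dPhi_eq, Pi.mul_apply, Dx_eq hs]
  · refine Filter.Eventually.of_forall fun n => ?_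
    rw [← ae_restrict_iff' measurableSet_uIoc, Set.uIoc_of_le ht.1]
    filter_upwards [hio] with s hs
    have hs' := Set.Ioo_subset_Icc_self hs
    have h1 := (mol_meas (P.mol n).smooth.continuous (h := fun _ => dLL S s) ((dLL_m hs).comp measurable_snd)).measurable
    have h2 : Measurable fun v => mol (η n) (dLL S s) v := h1.comp (f := fun v => ((0:ℝ), v)) (by fun_prop)
    have h3 := (P.cut n).smooth.continuous.measurable
    have hK := S.K2nonneg s
    simp only [dPhi_eq]
    exact (F_mom_lt V hs' (exp_facts S).2.2.2.1 (h3.mul h2).aestronglyMeasurable (inn_bd P hs' n) (by positivity)).2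
  · rw [← ae_restrict_iff' measurableSet_uIoc, Set.uIoc_of_le ht.1]
    filter_upwards [hio] with s hs
    exact inn_lim V P hs

theorem int_two (V : Ver S F W) {t : ℝ} (ht : t ∈ Set.Icc 0 T) :
    IntervalIntegrable (fun s => ∫ v, dLL S s v * F (s, v)) volume 0 t := by
  have hio := ae_Ioo ht
  have hK := (K2_int (S := S) ht 1 S.Mf)
  rw [intervalIntegrable_iff_integrableOn_Ioc_of_le ht.1] at hK ⊢
  have h3 := ((dLL_meas S).mul V.Fm).stronglyMeasurable.integral_prod_right' (ν := (volume : Measure V3))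
  refine Integrable.mono' hK (h3.aestronglyMeasurable.congr ?_) ?_
  · filter_upwards [hio] with s hs
    congr 1
    ext v
    simp only [Pi.mul_apply, Set.indicator_of_mem hs]
  · filter_upwards [hio] with s hs
    have hs' := Set.Ioo_subset_Icc_self hs
    have := (F_mom_lt V hs' (exp_facts S).2.2.2.1 (dLL_m hs).aestronglyMeasurable (dLL_bd S hs') (S.K2nonneg s)).2
    rw [mul_one]
    exact this

end

section
variable {γ T : ℝ} {S : Setting γ T} {F : ℝ × V3 → ℝ} {W : ℝ × (V3 × V3) → V3}
variable {A : ℝ} {η χ : ℕ → V3 → ℝ}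

/-- measurable version of the smoothed gradient -/
def Dc (S : Setting γ T) (e c : V3 → ℝ) (q : ℝ × V3) : V3 := ∫ w, LL S (clampT T q.1) w • EE e c w q.2

theorem Dc_eq {e c : V3 → ℝ} {s : ℝ} (hs : s ∈ Set.Icc 0 T) (v : V3) : Dc S e c (s, v) = Dn S e c s v := by
  unfold Dc Dn
  simp only [clampT_eq hs]

theorem Dc_meas {e c : V3 → ℝ} (he : ContDiff ℝ 2 e) (hc : ContDiff ℝ 2 c) : Measurable (Dc S e c) := by
  refine StronglyMeasurable.measurable ?_
  refine StronglyMeasurable.integral_prod_right' (f := fun z : (ℝ × V3) × V3 => LL S (clampT T z.1.1) z.2 • EE e c z.2 z.1.2) ?_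
  have h1 : Measurable fun z : (ℝ × V3) × V3 => LL S (clampT T z.1.1) z.2 := 
    (LLc_meas S).comp (f := fun z : (ℝ × V3) × V3 => (z.1.1, z.2)) (by fun_prop)
  have h2 : Measurable fun z : (ℝ × V3) × V3 => EE e c z.2 z.1.2 := 
    (EE_cont he hc).measurable.comp (f := fun z : (ℝ × V3) × V3 => (z.2, z.1.2)) (by fun_prop)
  exact (h1.smul h2).stronglyMeasurable

/-- integrand -/
def Jc (S : Setting γ T) (F : ℝ × V3 → ℝ) (W : ℝ × (V3 × V3) → V3) (e c : V3 → ℝ) (q : ℝ × (V3 × V3)) : ℝ :=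
  ⟪Dc S e c (q.1, q.2.1) - Dc S e c (q.1, q.2.2), Theta γ F W q⟫

theorem Jc_meas (V : Ver S F W) {e c : V3 → ℝ} (he : ContDiff ℝ 2 e) (hc : ContDiff ℝ 2 c) : Measurable (Jc S F W e c) := by
  have h1 := Dc_meas (S := S) he hc
  have h2 : Measurable fun q : ℝ × (V3 × V3) => Dc S e c (q.1, q.2.1) := h1.comp (by fun_prop)
  have h3 : Measurable fun q : ℝ × (V3 × V3) => Dc S e c (q.1, q.2.2) := h1.comp (by fun_prop)
  exact (h2.sub h3).inner (Theta_meas V)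

/-- dominating weight -/
def cA (S : Setting γ T) (A : ℝ) (s : ℝ) : ℝ := 4 * ((2 + 3 * A) * 2 ^ (S.κ + S.ζ + 1) * cS S s) ^ 2

theorem cA_nonneg (s : ℝ) : 0 ≤ cA S A s := by unfold cA; positivity

theorem Dn_lim (P : Appr A η χ) {s : ℝ} (hs : s ∈ Set.Icc 0 T) (v : V3) :
    Filter.Tendsto (fun n => Dn S (η n) (χ n) s v) Filter.atTop (nhds (logGrad (S.g s) v)) := by
  have h1 := (P.limc v).smul (P.lim3 _ (logGrad_cont S hs) v)
  have h2 := (P.lim1 _ (LL_vel S hs).continuous v).smul (P.limg v)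
  have h3 := h1.add h2
  simp only [one_smul, smul_zero, add_zero] at h3
  refine h3.congr fun n => ?_
  exact (Dn_eq (P.mol n).smooth (P.mol n).hcs hs v).symm

theorem in_lim (P : Appr A η χ) {s : ℝ} (hs : s ∈ Set.Icc 0 T) (p : V3 × V3) (x : V3) :
    Filter.Tendsto (fun n => (⟪Dn S (η n) (χ n) s p.1 - Dn S (η n) (χ n) s p.2, x⟫ : ℝ)) Filter.atTop 
      (nhds ⟪logGrad (S.g s) p.1 - logGrad (S.g s) p.2, x⟫) :=
  ((Dn_lim P hs p.1).sub (Dn_lim P hs p.2)).inner tendsto_const_nhds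

theorem three_facts (V : Ver S F W) (P : Appr A η χ) {t : ℝ} (ht : t ∈ Set.Icc 0 T) :
    IntervalIntegrable (fun s => ∫ p : V3 × V3, ⟪logGrad (S.g s) p.1 - logGrad (S.g s) p.2, Theta γ F W (s, p)⟫) volume 0 t ∧
    Filter.Tendsto (fun n => ∫ s in (0:ℝ)..t, ∫ p : V3 × V3, (⟪Dn S (η n) (χ n) s p.1 - Dn S (η n) (χ n) s p.2, Theta γ F W (s, p)⟫ : ℝ)) Filter.atTop 
      (nhds (∫ s in (0:ℝ)..t, ∫ p : V3 × V3, ⟪logGrad (S.g s) p.1 - logGrad (S.g s) p.2, Theta γ F W (s, p)⟫)) := by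
  have hD : Integrable (Dom S F W (cA S A)) ((volume.restrict (Set.Ioc 0 T)).prod volume) :=
    Dom_integrable V cA_nonneg (cS_int S _ _)
  have hsub := ae_mono (Measure.restrict_mono (Set.Ioc_subset_Ioc_right ht.2 : Set.Ioc 0 t ⊆ Set.Ioc 0 T) (le_refl (volume : Measure ℝ)))
  have hDs : ∀ᵐ s ∂(volume.restrict (Set.Ioc 0 t)), Integrable (fun p => Dom S F W (cA S A) (s, p)) := hsub hD.prod_right_ae
  have hDi : IntegrableOn (fun s => ∫ p, Dom S F W (cA S A) (s, p)) (Set.Ioc 0 t) := 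
    Integrable.mono_measure hD.integral_prod_left (Measure.restrict_mono (Set.Ioc_subset_Ioc_right ht.2) le_rfl)
  have hio : ∀ᵐ s ∂(volume.restrict (Set.Ioc 0 t)), s ∈ Set.Icc 0 T := (ae_Ioo ht).mono fun s h => Set.Ioo_subset_Icc_self h
  have hJ : ∀ n s, s ∈ Set.Icc 0 T → (fun p => Jc S F W (η n) (χ n) (s, p)) = fun p : V3 × V3 => 
      (⟪Dn S (η n) (χ n) s p.1 - Dn S (η n) (χ n) s p.2, Theta γ F W (s, p)⟫ : ℝ) := by
    intro n s hs
    ext p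
    unfold Jc
    simp only [Dc_eq hs]
  have hm : ∀ n s, s ∈ Set.Icc 0 T → AEStronglyMeasurable (fun p : V3 × V3 => 
      (⟪Dn S (η n) (χ n) s p.1 - Dn S (η n) (χ n) s p.2, Theta γ F W (s, p)⟫ : ℝ)) := by
    intro n s hs
    rw [← hJ n s hs]
    exact ((Jc_meas V (P.mol n).smooth (P.cut n).smooth).comp (f := fun p => (s, p)) (by fun_prop)).aestronglyMeasurable
  have hM : ∀ n, AEStronglyMeasurable (fun s => ∫ p : V3 × V3, 
      (⟪Dn S (η n) (χ n) s p.1 - Dn S (η n) (χ n) s p.2, Theta γ F W (s, p)⟫ : ℝ)) (volume.restrict (Set.Ioc 0 t)) := by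
    intro n
    have h3 := (Jc_meas V (P.mol n).smooth (P.cut n).smooth).stronglyMeasurable.integral_prod_right' (ν := (volume : Measure (V3 × V3)))
    refine h3.aestronglyMeasurable.congr ?_
    filter_upwards [hio] with s hs
    rw [hJ n s hs]
  have hdom : ∀ n s, s ∈ Set.Icc 0 T → ∀ p : V3 × V3, 
      ‖(⟪Dn S (η n) (χ n) s p.1 - Dn S (η n) (χ n) s p.2, Theta γ F W (s, p)⟫ : ℝ)‖ ≤ Dom S F W (cA S A) (s, p) :=
    fun n s hs p => Dn_dom P.hA V (P.mol n) (P.cut n) hs p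
  have hlim : ∀ᵐ s ∂(volume.restrict (Set.Ioc 0 t)), Filter.Tendsto (fun n => ∫ p : V3 × V3, 
      (⟪Dn S (η n) (χ n) s p.1 - Dn S (η n) (χ n) s p.2, Theta γ F W (s, p)⟫ : ℝ)) Filter.atTop
      (nhds (∫ p : V3 × V3, ⟪logGrad (S.g s) p.1 - logGrad (S.g s) p.2, Theta γ F W (s, p)⟫)) := by
    filter_upwards [hio, hDs] with s hs hd
    exact tendsto_integral_of_dominated_convergence _ (fun n => hm n s hs) hd 
      (fun n => Filter.Eventually.of_forall (hdom n s hs)) (Filter.Eventually.of_forall fun p => in_lim P hs p _)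
  have hbd : ∀ n, ∀ᵐ s ∂(volume.restrict (Set.Ioc 0 t)), ‖∫ p : V3 × V3, 
      (⟪Dn S (η n) (χ n) s p.1 - Dn S (η n) (χ n) s p.2, Theta γ F W (s, p)⟫ : ℝ)‖ ≤ ∫ p, Dom S F W (cA S A) (s, p) := by
    intro n
    filter_upwards [hio, hDs] with s hs hd
    exact norm_integral_le_of_norm_le hd (Filter.Eventually.of_forall (hdom n s hs))
  constructor
  · rw [intervalIntegrable_iff_integrableOn_Ioc_of_le ht.1]
    refine Integrable.mono' hDi (aestronglyMeasurable_of_tendsto_ae Filter.atTop hM hlim) ?_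
    filter_upwards [ae_all_iff.2 hbd, hlim] with s h1 h2
    exact le_of_tendsto' h2.norm h1
  · refine intervalIntegral.tendsto_integral_filter_of_dominated_convergence (fun s => ∫ p, Dom S F W (cA S A) (s, p)) ?_ ?_ ?_ ?_
    · rw [Set.uIoc_of_le ht.1]
      exact Filter.Eventually.of_forall hM
    · rw [Set.uIoc_of_le ht.1]
      exact Filter.Eventually.of_forall fun n => (ae_restrict_iff' measurableSet_Ioc).1 (hbd n)
    · rwa [intervalIntegrable_iff_integrableOn_Ioc_of_le ht.1]
    · rw [← ae_restrict_iff' measurableSet_uIoc, Set.uIoc_of_le ht.1]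
      exact hlim

end

/-- in Setting (⋆), ln g can be used as a test function in the weak
formulation for f, and each term is well-defined and finite (Lemma 1 of the paper). -/
theorem log_g_as_test_function (γ T : ℝ) (S : Setting γ T) :
    ∀ t ∈ Set.Icc (0 : ℝ) T,
      Integrable (fun v => Real.log (S.g t v) * S.f t v) ∧
      IntervalIntegrable
        (fun s => ∫ v, derivWithin (fun r => Real.log (S.g r v)) (Set.Icc 0 T) s * S.f s v)
        volume 0 t ∧
      IntervalIntegrable
        (fun s => ∫ p : V3 × V3,
          bilin (landauKernel γ (p.1 - p.2))
            (logGrad (S.g s) p.1 - logGrad (S.g s) p.2)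
            ((2 * Real.sqrt (S.f s p.1 * S.f s p.2)) • ((S.fGrad s p).1 - (S.fGrad s p).2)))
        volume 0 t ∧
      (∫ v, Real.log (S.g t v) * S.f t v) =
        (∫ v, Real.log (S.g 0 v) * S.f 0 v) +
        (∫ s in (0 : ℝ)..t,
          ∫ v, derivWithin (fun r => Real.log (S.g r v)) (Set.Icc 0 T) s * S.f s v) -
        (1 / 2) * ∫ s in (0 : ℝ)..t, ∫ p : V3 × V3,
          bilin (landauKernel γ (p.1 - p.2))
            (logGrad (S.g s) p.1 - logGrad (S.g s) p.2)
            ((2 * Real.sqrt (S.f s p.1 * S.f s p.2)) •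
              ((S.fGrad s p).1 - (S.fGrad s p).2)) := by
  intro t ht
  obtain ⟨F, W, V⟩ := exists_ver S
  obtain ⟨A, η, χ, P⟩ := exists_appr
  have h0T : (0:ℝ) ∈ Set.Icc 0 T := ⟨le_rfl, S.hT.le⟩
  obtain ⟨hi3, hl3⟩ := three_facts (S := S) V P ht
  have hi2 := int_two V ht
  have hl2 := lim_two V P ht
  have hl1 := lim_one V P ht
  have hl0 := lim_one V P h0T
  have main : (∫ v, LL S t v * F (t, v)) - (∫ v, LL S 0 v * F (0, v)) = (∫ s in (0:ℝ)..t, ∫ v, dLL S s v * F (s, v)) - 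
      ∫ s in (0:ℝ)..t, ∫ p : V3 × V3, ⟪logGrad (S.g s) p.1 - logGrad (S.g s) p.2, Theta γ F W (s, p)⟫ := by
    refine tendsto_nhds_unique (hl1.sub hl0) ((hl2.sub hl3).congr fun n => ?_)
    exact (approx_identity V (P.mol n).smooth (P.cut n).smooth (P.mol n).hcs (P.cut n).hcs ht).symm
  have hcf : ∀ s ∈ Set.Icc 0 T, ∀ h : V3 → ℝ, (fun v => h v * F (s, v)) =ᵐ[volume] fun v => h v * S.f s v := by
    intro s hs h
    filter_upwards [V.Feq s hs] with v hv
    rw [hv]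
  have hc1 : ∀ s ∈ Set.Icc 0 T, ∫ v, LL S s v * F (s, v) = ∫ v, Real.log (S.g s v) * S.f s v :=
    fun s hs => integral_congr_ae (hcf s hs _)
  have hc2 : ∀ s ∈ Set.Icc 0 T, ∫ v, dLL S s v * F (s, v) = 
      ∫ v, derivWithin (fun r => Real.log (S.g r v)) (Set.Icc 0 T) s * S.f s v :=
    fun s hs => integral_congr_ae (hcf s hs _)
  have hsub := ae_mono (Measure.restrict_mono (Set.Ioc_subset_Ioc_right ht.2 : Set.Ioc 0 t ⊆ Set.Ioc 0 T) (le_refl (volume : Measure ℝ)))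
  have hc3 : ∀ᵐ s ∂(volume.restrict (Set.Ioc 0 t)), 2 * (∫ p : V3 × V3, (⟪logGrad (S.g s) p.1 - logGrad (S.g s) p.2, Theta γ F W (s, p)⟫ : ℝ)) = 
      ∫ p : V3 × V3,
          bilin (landauKernel γ (p.1 - p.2))
            (logGrad (S.g s) p.1 - logGrad (S.g s) p.2)
            ((2 * Real.sqrt (S.f s p.1 * S.f s p.2)) • ((S.fGrad s p).1 - (S.fGrad s p).2)) := by
    filter_upwards [hsub (third_eq V (fun s => logGrad (S.g s)))] with s hs
    rw [← hs, ← integral_const_mul]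
    congr 1
    ext p
    rw [bilin_smul_right]
    ring
  refine ⟨?_, ?_, ?_, ?_⟩
  · have hK := S.K1nonneg t
    have hc := c0_nonneg S
    exact (integrable_congr (hcf t ht (LL S t))).1 (F_mom_lt V ht (exp_facts S).2.2.2.2.1 
      (LL_vel S ht).continuous.aestronglyMeasurable (LL_bd S ht) (by positivity)).1
  · refine hi2.congr ?_
    intro s hs
    rw [Set.uIoc_of_le ht.1] at hs
    exact hc2 s ⟨hs.1.le, hs.2.trans ht.2⟩
  · refine (hi3.const_mul 2).congr_ae ?_
    rw [Set.uIoc_of_le ht.1]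
    exact hc3
  · rw [← hc1 t ht, ← hc1 0 h0T]
    have e2 : (∫ s in (0 : ℝ)..t,
          ∫ v, derivWithin (fun r => Real.log (S.g r v)) (Set.Icc 0 T) s * S.f s v) = ∫ s in (0:ℝ)..t, ∫ v, dLL S s v * F (s, v) := by
      refine intervalIntegral.integral_congr fun s hs => ?_
      rw [Set.uIcc_of_le ht.1] at hs
      exact (hc2 s ⟨hs.1, hs.2.trans ht.2⟩).symm
    rw [e2]
    rw [intervalIntegral.integral_of_le ht.1] at main ⊢
    rw [intervalIntegral.integral_of_le ht.1] at main
    rw [intervalIntegral.integral_of_le ht.1, ← integral_congr_ae hc3, integral_const_mul]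
    linarith

end
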